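/- Quantitative proximity of rescaled minimizers to the ball: let n ≥ 2, α ∈ (0,n), r > 0. There exists a constant C = C(n,α,r) > 0 such that for every m > 0, every bounded convex set Ẽ ⊆ ℝⁿ with |Ẽ| = 1 that minimizes the rescaled energy Per_r(F) + m^{(n+1−α)/n} Φ_α(F) among bounded convex sets F with |F| = 1 satisfies inf_{x∈ℝⁿ} |Ẽ Δ B(x)| ≤ C · m^{(n+1−α)/n}, where B(x) is the ball of volume 1 centered at x. -/

import Mathlib

open MeasureTheory Metric Set Filter Bornology
open scoped ENNReal NNReal Pointwise

noncomputable section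

/-- The set of points of Lebesgue density one of `E ⊆ ℝⁿ`. -/
def densityOnePoints (n : ℕ) (E : Set (EuclideanSpace ℝ (Fin n))) :
    Set (EuclideanSpace ℝ (Fin n)) :=
  {x | Tendsto (fun ρ : ℝ => volume (E ∩ ball x ρ) / volume (ball x ρ))
        (nhdsWithin 0 (Ioi 0)) (nhds 1)}

/-- Minkowski sum `A ⊕ B_r = ⋃_{x ∈ A} B_r(x)`. -/
def minkSum (n : ℕ) (r : ℝ) (A : Set (EuclideanSpace ℝ (Fin n))) :
    Set (EuclideanSpace ℝ (Fin n)) :=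
  ⋃ x ∈ A, ball x r

/-- The nonlocal Minkowski perimeter `Per_r(E) = (1/(2r)) |(∂E) ⊕ B_r|`, where `∂E`
is the topological boundary of the density-one representative of `E`. -/
def perR (n : ℕ) (r : ℝ) (E : Set (EuclideanSpace ℝ (Fin n))) : ℝ≥0∞ :=
  volume (minkSum n r (frontier (densityOnePoints n E))) / ENNReal.ofReal (2 * r)

/-- The inner set `E ⊖ B_r = E \ ((∂E) ⊕ B_r)` (for the density-one representative). -/
def minkSub (n : ℕ) (r : ℝ) (E : Set (EuclideanSpace ℝ (Fin n))) :
    Set (EuclideanSpace ℝ (Fin n)) :=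
  densityOnePoints n E \ minkSum n r (frontier (densityOnePoints n E))

/-- The Riesz energy `Φ_α(E) = ∫_E ∫_E |x-y|^{-α} dx dy`. -/
def rieszEnergy (n : ℕ) (α : ℝ) (E : Set (EuclideanSpace ℝ (Fin n))) : ℝ≥0∞ :=
  ∫⁻ x in E, ∫⁻ y in E, edist x y ^ (-α)

/-- The radius of the ball in `ℝⁿ` with unit volume. -/
def unitRadius (n : ℕ) : ℝ :=
  (volume (ball (0 : EuclideanSpace ℝ (Fin n)) 1)).toReal ^ (-(n : ℝ)⁻¹)

/-- A rigid motion of `ℝⁿ`: a rotation followed by a translation. -/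
def IsRigidMotion (n : ℕ) (g : EuclideanSpace ℝ (Fin n) → EuclideanSpace ℝ (Fin n)) : Prop :=
  ∃ (R : EuclideanSpace ℝ (Fin n) ≃ₗᵢ[ℝ] EuclideanSpace ℝ (Fin n))
    (v : EuclideanSpace ℝ (Fin n)),
    LinearMap.det (R.toLinearEquiv : EuclideanSpace ℝ (Fin n) →ₗ[ℝ] EuclideanSpace ℝ (Fin n)) = 1 ∧
    ∀ x, g x = R x + v


/-- One-dimensional Brunn-Minkowski inequality. -/
theorem bm_one_dim (A B : Set ℝ) (hA : MeasurableSet A) (hB : MeasurableSet B)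
    (hA0 : A.Nonempty) (hB0 : B.Nonempty) :
    volume A + volume B ≤ volume (A + B) := by
  have key : ∀ K ⊆ A, IsCompact K → ∀ M ⊆ B, IsCompact M →
      volume K + volume M ≤ volume (A + B) := by
    intro K hKA hK M hMB hM
    rcases K.eq_empty_or_nonempty with rfl | hKn
    · rw [measure_empty, zero_add]
      obtain ⟨a, ha⟩ := hA0
      calc volume M = volume ((fun x => a + x) '' M) := by
            rw [image_add_left, measure_preimage_add]
        _ ≤ _ := measure_mono (by rintro _ ⟨x, hx, rfl⟩; exact add_mem_add ha (hMB hx))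
    rcases M.eq_empty_or_nonempty with rfl | hMn
    · rw [measure_empty, add_zero]
      obtain ⟨b, hb⟩ := hB0
      calc volume K = volume ((fun x => x + b) '' K) := by
            rw [image_add_right, measure_preimage_add_right]
        _ ≤ _ := measure_mono (by rintro _ ⟨x, hx, rfl⟩; exact add_mem_add (hKA hx) hb)
    have h1 := hK.sSup_mem hKn
    have h2 := hM.sInf_mem hMn
    set k := sSup K
    set l := sInf M
    have e1 : volume K = volume ((fun x => x + l) '' K) := by
      rw [image_add_right, measure_preimage_add_right]
    have e2 : volume M = volume ((fun x => k + x) '' M) := by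
      rw [image_add_left, measure_preimage_add]
    have hintg : ((fun x => x + l) '' K) ∩ ((fun x => k + x) '' M) ⊆ {k + l} := by
      rintro z ⟨⟨x, hx, rfl⟩, ⟨y, hy, hxy⟩⟩
      have hx' : x ≤ k := le_csSup hK.bddAbove hx
      have hy' : l ≤ y := csInf_le hM.bddBelow hy
      simp only [mem_singleton_iff]
      simp only at hxy
      linarith
    rw [e1, e2]
    have m2 : MeasurableSet ((fun x => k + x) '' M) :=
      (hM.image (by fun_prop)).measurableSet
    rw [← measure_union_add_inter _ m2]
    rw [measure_mono_null hintg (by simp), add_zero]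
    apply measure_mono
    rintro z (⟨x, hx, rfl⟩ | ⟨x, hx, rfl⟩)
    · exact add_mem_add (hKA hx) (hMB h2)
    · exact add_mem_add (hKA h1) (hMB hx)
  rw [hA.measure_eq_iSup_isCompact, hB.measure_eq_iSup_isCompact]
  have e : ∀ S : Set ℝ, (⨆ K, ⨆ (_ : K ⊆ S), ⨆ (_ : IsCompact K), volume K)
      = ⨆ K, ⨆ (_ : K ⊆ S ∧ IsCompact K), volume K := by
    intro S; simp_rw [iSup_and]
  rw [e, e]
  apply ENNReal.biSup_add_biSup_le' ⟨∅, by simp⟩ ⟨∅, by simp⟩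
  rintro K ⟨h1, h2⟩ M ⟨h3, h4⟩
  exact key K h1 h2 M h3 h4

/-- Truncated layer cake formula. -/
theorem layer_cake_trunc {f : ℝ → ℝ≥0∞} (hf : Measurable f) :
    ∫⁻ t in Ioo (0:ℝ) 1, volume {x | ENNReal.ofReal t < f x} = ∫⁻ x, min (f x) 1 := by
  set S : Set (ℝ × ℝ) := {p | p.2 ∈ Ioo (0:ℝ) 1 ∧ ENNReal.ofReal p.2 < f p.1} with hS
  have hSm : MeasurableSet S := by
    apply MeasurableSet.inter
    · exact measurable_snd measurableSet_Ioo
    · exact measurableSet_lt (f := fun p : ℝ × ℝ => ENNReal.ofReal p.2)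
        (g := fun p : ℝ × ℝ => f p.1) (by fun_prop) (by fun_prop)
  have h1 := Measure.prod_apply (μ := (volume : Measure ℝ)) (ν := (volume : Measure ℝ)) hSm
  have h2 := Measure.prod_apply_symm (μ := (volume : Measure ℝ)) (ν := (volume : Measure ℝ)) hSm
  have h3 : ∀ x, volume (Prod.mk x ⁻¹' S) = min (f x) 1 := by
    intro x
    rcases eq_or_ne (min (f x) 1) 0 with h0 | h0
    · rw [h0]
      have : f x = 0 := by
        rcases min_choice (f x) 1 with h | h <;> simp_all
      have : Prod.mk x ⁻¹' S = ∅ := by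
        ext t; simp [hS, this]
      simp [this]
    · have hne : min (f x) 1 ≠ ⊤ := (lt_of_le_of_lt (min_le_right _ _) (by simp)).ne
      have : Prod.mk x ⁻¹' S = Ioo 0 (min (f x) 1).toReal := by
        ext t
        simp only [hS, mem_preimage, mem_ofPred_eq, mem_Ioo]
        constructor
        · rintro ⟨⟨a, b⟩, c⟩
          refine ⟨a, ?_⟩
          rw [← ENNReal.ofReal_lt_iff_lt_toReal a.le hne, lt_min_iff]
          exact ⟨c, by simpa using b⟩
        · rintro ⟨a, b⟩
          rw [← ENNReal.ofReal_lt_iff_lt_toReal a.le hne, lt_min_iff] at b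
          exact ⟨⟨a, by simpa using b.2⟩, b.1⟩
      rw [this, Real.volume_Ioo, sub_zero, ENNReal.ofReal_toReal hne]
  have h4 : ∀ t, volume ((fun x => (x, t)) ⁻¹' S)
      = (Ioo (0:ℝ) 1).indicator (fun t => volume {x | ENNReal.ofReal t < f x}) t := by
    intro t
    by_cases ht : t ∈ Ioo (0:ℝ) 1
    · rw [indicator_of_mem ht]; congr 1; ext x; simp only [hS, mem_preimage, mem_ofPred_eq, ht, true_and]
    · rw [indicator_of_notMem ht]
      have : (fun x => (x, t)) ⁻¹' S = ∅ := by
        ext x; simp only [hS, mem_preimage, mem_ofPred_eq, ht, false_and, mem_empty_iff_false]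
      simp [this]
  simp_rw [h3] at h1
  simp_rw [h4] at h2
  rw [lintegral_indicator measurableSet_Ioo] at h2
  rw [← h1, ← h2]


theorem ennreal_amgm {a b : ℝ} (ha : 0 < a) (hb : 0 < b) (hab : a + b = 1) (x y : ℝ≥0∞) :
    x ^ a * y ^ b ≤ ENNReal.ofReal a * x + ENNReal.ofReal b * y := by
  have ha' : ENNReal.ofReal a ≠ 0 := by simpa using ha
  have hb' : ENNReal.ofReal b ≠ 0 := by simpa using hb
  induction x with
  | top => simp [ENNReal.mul_top ha']
  | coe x =>
    induction y with
    | top => simp [ENNReal.mul_top hb']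
    | coe y =>
      rw [← ENNReal.coe_rpow_of_nonneg _ ha.le, ← ENNReal.coe_rpow_of_nonneg _ hb.le]
      have := NNReal.geom_mean_le_arith_mean2_weighted a.toNNReal b.toNNReal x y
        (by rw [← Real.toNNReal_add ha.le hb.le, hab]; simp)
      simp only [Real.coe_toNNReal _ ha.le, Real.coe_toNNReal _ hb.le] at this
      unfold ENNReal.ofReal
      exact_mod_cast this

/-- normalized one-dimensional Prékopa-Leindler inequality -/
theorem pl_one_norm {a b : ℝ} (ha : 0 < a) (hb : 0 < b)
    {f g h : ℝ → ℝ≥0∞} (hf : Measurable f) (hg : Measurable g) (hh : Measurable h)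
    (hf1 : ∀ x, f x ≤ 1) (hg1 : ∀ x, g x ≤ 1)
    (hf2 : ∀ t < 1, ∃ x, t < f x) (hg2 : ∀ t < 1, ∃ x, t < g x)
    (hab : a + b = 1)
    (hfgh : ∀ x y, f x ^ a * g y ^ b ≤ h (a * x + b * y)) :
    ENNReal.ofReal a * (∫⁻ x, f x) + ENNReal.ofReal b * (∫⁻ x, g x) ≤ ∫⁻ x, h x := by
  have lf : ∫⁻ x, f x = ∫⁻ t in Ioo (0:ℝ) 1, volume {x | ENNReal.ofReal t < f x} := by
    rw [layer_cake_trunc hf]; congr 1; ext x; rw [min_eq_left (hf1 x)]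
  have lg : ∫⁻ x, g x = ∫⁻ t in Ioo (0:ℝ) 1, volume {x | ENNReal.ofReal t < g x} := by
    rw [layer_cake_trunc hg]; congr 1; ext x; rw [min_eq_left (hg1 x)]
  have lh : ∫⁻ t in Ioo (0:ℝ) 1, volume {x | ENNReal.ofReal t < h x} ≤ ∫⁻ x, h x := by
    rw [layer_cake_trunc hh]; exact lintegral_mono fun x => min_le_left _ _
  refine le_trans ?_ lh
  rw [lf, lg, ← lintegral_const_mul' _ _ (by simp), ← lintegral_const_mul' _ _ (by simp)]
  refine le_trans (le_lintegral_add _ _) ?_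
  apply setLIntegral_mono' measurableSet_Ioo
  rintro t ⟨ht0, ht1⟩
  have m1 : MeasurableSet {x | ENNReal.ofReal t < f x} := measurableSet_lt measurable_const hf
  have m2 : MeasurableSet {x | ENNReal.ofReal t < g x} := measurableSet_lt measurable_const hg
  have s1 : ENNReal.ofReal a * volume {x | ENNReal.ofReal t < f x}
      = volume (a • {x | ENNReal.ofReal t < f x}) := by
    rw [Measure.addHaar_smul]; simp [abs_of_pos ha]
  have s2 : ENNReal.ofReal b * volume {x | ENNReal.ofReal t < g x}
      = volume (b • {x | ENNReal.ofReal t < g x}) := by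
    rw [Measure.addHaar_smul]; simp [abs_of_pos hb]
  rw [s1, s2]
  have ht1' : ENNReal.ofReal t < 1 := by simpa using ht1
  have n1 := hf2 _ ht1'
  have n2 := hg2 _ ht1'
  refine le_trans (bm_one_dim _ _ (m1.const_smul_of_ne_zero ha.ne')
    (m2.const_smul_of_ne_zero hb.ne') (Nonempty.smul_set n1) (Nonempty.smul_set n2)) ?_
  apply measure_mono
  rintro _ ⟨_, ⟨x, hx, rfl⟩, _, ⟨y, hy, rfl⟩, rfl⟩
  refine lt_of_lt_of_le ?_ (hfgh x y)
  have t0 : ENNReal.ofReal t ≠ 0 := by simpa using ht0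
  calc ENNReal.ofReal t = ENNReal.ofReal t ^ a * ENNReal.ofReal t ^ b := by
        rw [← ENNReal.rpow_add _ _ t0 (by simp), hab, ENNReal.rpow_one]
    _ < f x ^ a * g y ^ b := by
      apply ENNReal.mul_lt_mul
      · exact ENNReal.rpow_lt_rpow hx ha
      · exact ENNReal.rpow_lt_rpow hy hb

/-- bounded one-dimensional Prékopa-Leindler inequality -/
theorem pl_one_bdd {a b : ℝ} (ha : 0 < a) (hb : 0 < b)
    {f g h : ℝ → ℝ≥0∞} (hf : Measurable f) (hg : Measurable g) (hh : Measurable h)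
    {N M : ℝ≥0∞} (hN : N ≠ ⊤) (hM : M ≠ ⊤)
    (hf1 : ∀ x, f x ≤ N) (hg1 : ∀ x, g x ≤ M)
    (hab : a + b = 1)
    (hfgh : ∀ x y, f x ^ a * g y ^ b ≤ h (a * x + b * y)) :
    (∫⁻ x, f x) ^ a * (∫⁻ x, g x) ^ b ≤ ∫⁻ x, h x := by
  set F := ⨆ x, f x with hF
  set G := ⨆ x, g x with hG
  have hFt : F ≠ ⊤ := (lt_of_le_of_lt (iSup_le hf1) hN.lt_top).ne
  have hGt : G ≠ ⊤ := (lt_of_le_of_lt (iSup_le hg1) hM.lt_top).ne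
  rcases eq_or_ne F 0 with hF0 | hF0
  · have : ∀ x, f x = 0 := fun x => le_antisymm (hF0 ▸ le_iSup f x) (zero_le)
    simp [this, ENNReal.zero_rpow_of_pos ha]
  rcases eq_or_ne G 0 with hG0 | hG0
  · have : ∀ x, g x = 0 := fun x => le_antisymm (hG0 ▸ le_iSup g x) (zero_le)
    simp [this, ENNReal.zero_rpow_of_pos hb]
  set H := F ^ a * G ^ b with hH
  have hFa0 : F ^ a ≠ 0 := by simp [ENNReal.rpow_eq_zero_iff, hF0, hFt]
  have hGb0 : G ^ b ≠ 0 := by simp [ENNReal.rpow_eq_zero_iff, hG0, hGt]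
  have hFat : F ^ a ≠ ⊤ := ENNReal.rpow_ne_top_of_nonneg ha.le hFt
  have hGbt : G ^ b ≠ ⊤ := ENNReal.rpow_ne_top_of_nonneg hb.le hGt
  have hH0 : H ≠ 0 := mul_ne_zero hFa0 hGb0
  have hHt : H ≠ ⊤ := ENNReal.mul_ne_top hFat hGbt
  have key := pl_one_norm (f := fun x => F⁻¹ * f x) (g := fun x => G⁻¹ * g x)
    (h := fun x => H⁻¹ * h x) ha hb (by fun_prop) (by fun_prop) (by fun_prop)
    (fun x => by
      calc F⁻¹ * f x ≤ F⁻¹ * F := by gcongr; exact le_iSup f x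
        _ = 1 := ENNReal.inv_mul_cancel hF0 hFt)
    (fun x => by
      calc G⁻¹ * g x ≤ G⁻¹ * G := by gcongr; exact le_iSup g x
        _ = 1 := ENNReal.inv_mul_cancel hG0 hGt)
    (fun t ht => by
      have : t * F < F := by
        calc t * F < 1 * F := by
              exact ENNReal.mul_lt_mul_left hF0 hFt ht
          _ = F := one_mul _
      obtain ⟨x, hx⟩ := lt_iSup_iff.1 this
      refine ⟨x, ?_⟩
      rw [mul_comm, ← div_eq_mul_inv]
      exact (ENNReal.lt_div_iff_mul_lt (Or.inl hF0) (Or.inl hFt)).2 hx)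
    (fun t ht => by
      have : t * G < G := by
        calc t * G < 1 * G := by
              exact ENNReal.mul_lt_mul_left hG0 hGt ht
          _ = G := one_mul _
      obtain ⟨x, hx⟩ := lt_iSup_iff.1 this
      refine ⟨x, ?_⟩
      rw [mul_comm, ← div_eq_mul_inv]
      exact (ENNReal.lt_div_iff_mul_lt (Or.inl hG0) (Or.inl hGt)).2 hx)
    hab
    (fun x y => by
      rw [ENNReal.mul_rpow_of_nonneg _ _ ha.le, ENNReal.mul_rpow_of_nonneg _ _ hb.le,
        ENNReal.inv_rpow, ENNReal.inv_rpow, hH,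
        ENNReal.mul_inv (Or.inl hFa0) (Or.inl hFat), mul_mul_mul_comm]
      gcongr
      exact hfgh x y)
  have key2 := (ennreal_amgm ha hb hab _ _).trans key
  rw [lintegral_const_mul _ hf, lintegral_const_mul _ hg, lintegral_const_mul _ hh,
    ENNReal.mul_rpow_of_nonneg _ _ ha.le, ENNReal.mul_rpow_of_nonneg _ _ hb.le,
        ENNReal.inv_rpow, ENNReal.inv_rpow, mul_mul_mul_comm,
        ← ENNReal.mul_inv (Or.inl hFa0) (Or.inl hFat), ← hH] at key2
  exact (ENNReal.mul_le_mul_iff_right (ENNReal.inv_ne_zero.2 hHt) (ENNReal.inv_ne_top.2 hH0)).1 key2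

/-- The Prékopa-Leindler property of a measure. -/
def PLProp (V : Type) [AddCommGroup V] [Module ℝ V] [MeasurableSpace V] (μ : Measure V) : Prop :=
  ∀ a b : ℝ, 0 < a → 0 < b → a + b = 1 → ∀ f g h : V → ℝ≥0∞,
    Measurable f → Measurable g → Measurable h →
    (∀ x y, f x ^ a * g y ^ b ≤ h (a • x + b • y)) →
    (∫⁻ x, f x ∂μ) ^ a * (∫⁻ x, g x ∂μ) ^ b ≤ ∫⁻ x, h x ∂μ

theorem lintegral_min_nat {f : ℝ → ℝ≥0∞} (hf : Measurable f) :
    ∫⁻ x, f x = ⨆ N : ℕ, ∫⁻ x, min (f x) N := by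
  rw [← lintegral_iSup (by fun_prop)]
  · congr 1; ext x
    rw [← inf_iSup_eq, ENNReal.iSup_natCast]; simp
  · intro i j hij x
    simp only
    gcongr

theorem pl_real : PLProp ℝ volume := by
  intro a b ha hb hab f g h hf hg hh hfgh
  rw [lintegral_min_nat hf, lintegral_min_nat hg]
  have e1 : ∀ (c : ℝ) (hc : 0 < c) (u : ℕ → ℝ≥0∞), (⨆ i, u i) ^ c = ⨆ i, (u i) ^ c := by
    intro c hc u
    exact (ENNReal.orderIsoRpow c hc).map_iSup u
  rw [e1 a ha, e1 b hb, ENNReal.iSup_mul]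
  refine iSup_le fun i => ?_
  rw [ENNReal.mul_iSup]
  refine iSup_le fun j => ?_
  apply pl_one_bdd ha hb (by fun_prop) (by fun_prop) hh (ENNReal.natCast_ne_top i)
    (ENNReal.natCast_ne_top j) (fun x => min_le_right _ _) (fun x => min_le_right _ _) hab
  intro x y
  refine le_trans ?_ (hfgh x y)
  gcongr <;> exact min_le_left _ _

theorem PLProp.prod {V W : Type} [AddCommGroup V] [Module ℝ V] [MeasurableSpace V]
    [AddCommGroup W] [Module ℝ W] [MeasurableSpace W] {μ : Measure V} {ν : Measure W}
    [SFinite μ] [SFinite ν] (h1 : PLProp V μ) (h2 : PLProp W ν) : PLProp (V × W) (μ.prod ν) := by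
  intro a b ha hb hab f g h hf hg hh hfgh
  rw [lintegral_prod _ hf.aemeasurable, lintegral_prod _ hg.aemeasurable,
    lintegral_prod _ hh.aemeasurable]
  apply h1 a b ha hb hab _ _ _ hf.lintegral_prod_right' hg.lintegral_prod_right'
    hh.lintegral_prod_right'
  intro x x'
  apply h2 a b ha hb hab _ _ _ (by fun_prop) (by fun_prop) (by fun_prop)
  intro y y'
  exact hfgh (x, y) (x', y')

theorem PLProp.map {V W : Type} [AddCommGroup V] [Module ℝ V] [MeasurableSpace V]
    [AddCommGroup W] [Module ℝ W] [MeasurableSpace W] {μ : Measure V} {ν : Measure W}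
    (h1 : PLProp V μ) (e : V → W) (he : MeasurePreserving e μ ν)
    (hlin : ∀ (a b : ℝ) (x y : V), e (a • x + b • y) = a • e x + b • e y) : PLProp W ν := by
  intro a b ha hb hab f g h hf hg hh hfgh
  rw [← he.lintegral_comp hf, ← he.lintegral_comp hg, ← he.lintegral_comp hh]
  apply h1 a b ha hb hab _ _ _ (hf.comp he.measurable) (hg.comp he.measurable)
    (hh.comp he.measurable)
  intro x y
  simp only [Function.comp_apply]
  rw [hlin]
  exact hfgh _ _

theorem pl_pi (n : ℕ) : PLProp (Fin n → ℝ) volume := by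
  induction n with
  | zero =>
    intro a b ha hb hab f g h hf hg hh hfgh
    have : (volume : Measure (Fin 0 → ℝ)) = Measure.dirac 0 := by
      rw [volume_pi, Measure.pi_of_empty _ 0]
    rw [this, lintegral_dirac' _ hf, lintegral_dirac' _ hg, lintegral_dirac' _ hh]
    simpa using hfgh 0 0
  | succ n ih =>
    refine (pl_real.prod ih).map _ (volume_preserving_piFinSuccAbove (fun _ => ℝ) 0).symm ?_
    intro a b x y
    funext i
    refine Fin.cases ?_ (fun j => ?_) i <;> 
    simp [MeasurableEquiv.piFinSuccAbove_symm_apply]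

theorem pl_euclidean (n : ℕ) : PLProp (EuclideanSpace ℝ (Fin n)) volume := by
  refine (pl_pi n).map _ (PiLp.volume_preserving_toLp (Fin n)) ?_
  intro a b x y
  simp


theorem scale_weight {n k : ℕ} {w : EuclideanSpace ℝ (Fin n) → ℝ≥0∞} (hw : Measurable w)
    (hhom : ∀ c : ℝ, 0 < c → ∀ x, w (c • x) = ENNReal.ofReal c ^ k * w x)
    {c : ℝ} (hc : 0 < c) {A : Set (EuclideanSpace ℝ (Fin n))} (hA : MeasurableSet A) :
    ∫⁻ x in c • A, w x = ENNReal.ofReal (c ^ (n + k)) * ∫⁻ x in A, w x := by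
  have hm : Measurable (fun x : EuclideanSpace ℝ (Fin n) => c • x) := by fun_prop
  have h1 := Measure.map_addHaar_smul (volume : Measure (EuclideanSpace ℝ (Fin n))) hc.ne'
  have h2 : ∫⁻ x, (c • A).indicator w x ∂(Measure.map (fun x => c • x) volume)
      = ∫⁻ x, (c • A).indicator w (c • x) :=
    lintegral_map (hw.indicator (hA.const_smul_of_ne_zero hc.ne')) hm
  have h1' : Measure.map (fun x : EuclideanSpace ℝ (Fin n) => c • x) volume
      = ENNReal.ofReal (c ^ n)⁻¹ • volume := by
    have : (fun x : EuclideanSpace ℝ (Fin n) => c • x) = (c • ·) := rfl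
    rw [this, h1]; simp [abs_of_pos hc]
  rw [h1', lintegral_smul_measure, lintegral_indicator (hA.const_smul_of_ne_zero hc.ne')] at h2
  have h3 : ∀ x, (c • A).indicator w (c • x) = ENNReal.ofReal c ^ k * A.indicator w x := by
    intro x
    by_cases hx : x ∈ A
    · rw [indicator_of_mem hx, indicator_of_mem (smul_mem_smul_set hx), hhom c hc]
    · rw [indicator_of_notMem hx, indicator_of_notMem]
      · simp
      · rwa [smul_mem_smul_set_iff₀ hc.ne']
  simp_rw [h3] at h2
  rw [lintegral_const_mul' _ _ (by simp), lintegral_indicator hA] at h2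
  have hcn : 0 < c ^ n := by positivity
  rw [pow_add, ENNReal.ofReal_mul hcn.le, ENNReal.ofReal_pow hc.le k, mul_assoc, ← h2, smul_eq_mul,
    ← mul_assoc, ← ENNReal.ofReal_mul hcn.le, mul_inv_cancel₀ hcn.ne']
  simp

/-- weighted Brunn-Minkowski inequality for open sets -/
theorem bm_weight_open {n k : ℕ} {w : EuclideanSpace ℝ (Fin n) → ℝ≥0∞} (hw : Measurable w)
    (hhom : ∀ c : ℝ, 0 < c → ∀ x, w (c • x) = ENNReal.ofReal c ^ k * w x)
    (hlog : ∀ a b : ℝ, 0 < a → 0 < b → a + b = 1 → ∀ x y, w x ^ a * w y ^ b ≤ w (a • x + b • y))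
    {A B : Set (EuclideanSpace ℝ (Fin n))} (hA : IsOpen A) (hB : IsOpen B)
    {α β : ℝ} (hα : 0 < α) (hβ : 0 < β)
    (h1 : ENNReal.ofReal (α ^ (n + k)) ≤ ∫⁻ x in A, w x)
    (h2 : ENNReal.ofReal (β ^ (n + k)) ≤ ∫⁻ x in B, w x) :
    ENNReal.ofReal ((α + β) ^ (n + k)) ≤ ∫⁻ x in A + B, w x := by
  set a := α / (α + β)
  set b := β / (α + β)
  have hs : 0 < α + β := by positivity
  have ha : 0 < a := by positivity
  have hb : 0 < b := by positivity
  have hab : a + b = 1 := by simp only [a, b]; field_simp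
  set A' := α⁻¹ • A
  set B' := β⁻¹ • B
  set C' := (α + β)⁻¹ • (A + B)
  have hA'm : MeasurableSet A' := (hA.smul₀ (inv_pos.2 hα).ne').measurableSet
  have hB'm : MeasurableSet B' := (hB.smul₀ (inv_pos.2 hβ).ne').measurableSet
  have hCo : IsOpen (A + B) := hA.add_right
  have hC'm : MeasurableSet C' := (hCo.smul₀ (inv_pos.2 hs).ne').measurableSet
  have key := pl_euclidean n a b ha hb hab (A'.indicator w) (B'.indicator w) (C'.indicator w)
    (hw.indicator hA'm) (hw.indicator hB'm) (hw.indicator hC'm) (by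
      intro x y
      by_cases hx : x ∈ A'
      · by_cases hy : y ∈ B'
        · have : a • x + b • y ∈ C' := by
            obtain ⟨x', hx', rfl⟩ := hx
            obtain ⟨y', hy', rfl⟩ := hy
            refine ⟨x' + y', add_mem_add hx' hy', ?_⟩
            simp only [a, b, smul_smul, smul_add]
            congr 2 <;> field_simp
          rw [indicator_of_mem hx, indicator_of_mem hy, indicator_of_mem this]
          exact hlog a b ha hb hab x y
        · rw [indicator_of_notMem hy, ENNReal.zero_rpow_of_pos hb]; simp
      · rw [indicator_of_notMem hx, ENNReal.zero_rpow_of_pos ha]; simp)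
  rw [lintegral_indicator hA'm, lintegral_indicator hB'm, lintegral_indicator hC'm,
    scale_weight hw hhom (inv_pos.2 hα) hA.measurableSet,
    scale_weight hw hhom (inv_pos.2 hβ) hB.measurableSet,
    scale_weight hw hhom (inv_pos.2 hs) hCo.measurableSet] at key
  have g : ∀ γ : ℝ, 0 < γ → ∀ I : ℝ≥0∞, ENNReal.ofReal (γ ^ (n + k)) ≤ I →
      1 ≤ ENNReal.ofReal (γ⁻¹ ^ (n + k)) * I := by
    intro γ hγ I hI
    calc (1 : ℝ≥0∞) = ENNReal.ofReal (γ⁻¹ ^ (n + k)) * ENNReal.ofReal (γ ^ (n + k)) := by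
          rw [← ENNReal.ofReal_mul (by positivity), ← mul_pow, inv_mul_cancel₀ hγ.ne']; simp
      _ ≤ _ := by gcongr
  have k1 := ENNReal.rpow_le_rpow (g α hα _ h1) ha.le
  have k2 := ENNReal.rpow_le_rpow (g β hβ _ h2) hb.le
  rw [ENNReal.one_rpow] at k1 k2
  have k3 : 1 ≤ ENNReal.ofReal ((α + β)⁻¹ ^ (n + k)) * ∫⁻ x in A + B, w x := by
    refine le_trans ?_ key
    calc (1 : ℝ≥0∞) = 1 * 1 := by simp
      _ ≤ _ := by gcongr
  calc ENNReal.ofReal ((α + β) ^ (n + k)) = ENNReal.ofReal ((α + β) ^ (n + k)) * 1 := by simp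
    _ ≤ ENNReal.ofReal ((α + β) ^ (n + k)) *
      (ENNReal.ofReal ((α + β)⁻¹ ^ (n + k)) * ∫⁻ x in A + B, w x) := by gcongr
    _ = _ := by
      rw [← mul_assoc, ← ENNReal.ofReal_mul (by positivity), ← mul_pow, mul_inv_cancel₀ hs.ne']
      simp

theorem convex_ae_interior {n : ℕ} {K : Set (EuclideanSpace ℝ (Fin n))} (hK : Convex ℝ K) :
    (interior K : Set (EuclideanSpace ℝ (Fin n))) =ᵐ[volume] K :=
  interior_ae_eq_of_null_frontier (hK.addHaar_frontier volume)

/-- weighted Brunn-Minkowski inequality for convex sets -/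
theorem bm_weight {n k : ℕ} {w : EuclideanSpace ℝ (Fin n) → ℝ≥0∞} (hw : Measurable w)
    (hhom : ∀ c : ℝ, 0 < c → ∀ x, w (c • x) = ENNReal.ofReal c ^ k * w x)
    (hlog : ∀ a b : ℝ, 0 < a → 0 < b → a + b = 1 → ∀ x y, w x ^ a * w y ^ b ≤ w (a • x + b • y))
    {A B : Set (EuclideanSpace ℝ (Fin n))} (hA : Convex ℝ A) (hB : Convex ℝ B)
    {α β : ℝ} (hα : 0 < α) (hβ : 0 < β)
    (h1 : ENNReal.ofReal (α ^ (n + k)) ≤ ∫⁻ x in A, w x)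
    (h2 : ENNReal.ofReal (β ^ (n + k)) ≤ ∫⁻ x in B, w x) :
    ENNReal.ofReal ((α + β) ^ (n + k)) ≤ ∫⁻ x in A + B, w x := by
  rw [← setLIntegral_congr (convex_ae_interior hA)] at h1
  rw [← setLIntegral_congr (convex_ae_interior hB)] at h2
  exact (bm_weight_open hw hhom hlog isOpen_interior isOpen_interior hα hβ h1 h2).trans
    (lintegral_mono_set (add_subset_add interior_subset interior_subset))

/-- Brunn-Minkowski for convex sets -/
theorem bm_convex {n : ℕ} 
    {A B : Set (EuclideanSpace ℝ (Fin n))} (hA : Convex ℝ A) (hB : Convex ℝ B)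
    {α β : ℝ} (hα : 0 < α) (hβ : 0 < β)
    (h1 : ENNReal.ofReal (α ^ n) ≤ volume A)
    (h2 : ENNReal.ofReal (β ^ n) ≤ volume B) :
    ENNReal.ofReal ((α + β) ^ n) ≤ volume (A + B) := by
  have := bm_weight (n := n) (k := 0) (w := fun _ => 1) measurable_const (by simp) (by simp)
    hA hB hα hβ (by simpa using h1) (by simpa using h2)
  simpa using this

/-- Brunn-Minkowski type inequality for half space second moments -/
theorem bm_half {n : ℕ} (l : EuclideanSpace ℝ (Fin n) →L[ℝ] ℝ)
    {A B : Set (EuclideanSpace ℝ (Fin n))} (hA : Convex ℝ A) (hB : Convex ℝ B)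
    {α β : ℝ} (hα : 0 < α) (hβ : 0 < β)
    (h1 : ENNReal.ofReal (α ^ (n + 2)) ≤ ∫⁻ x in A, ENNReal.ofReal (l x) ^ 2)
    (h2 : ENNReal.ofReal (β ^ (n + 2)) ≤ ∫⁻ x in B, ENNReal.ofReal (l x) ^ 2) :
    ENNReal.ofReal ((α + β) ^ (n + 2)) ≤ ∫⁻ x in A + B, ENNReal.ofReal (l x) ^ 2 := by
  refine bm_weight (w := fun x => ENNReal.ofReal (l x) ^ 2) (by fun_prop) ?_ ?_ hA hB hα hβ h1 h2
  · intro c hc x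
    simp [ENNReal.ofReal_mul hc.le, mul_pow]
  · intro a b ha hb hab x y
    rcases le_or_gt (l x) 0 with hx | hx
    · rw [ENNReal.ofReal_of_nonpos hx]; simp [ENNReal.zero_rpow_of_pos ha]
    rcases le_or_gt (l y) 0 with hy | hy
    · rw [ENNReal.ofReal_of_nonpos hy]; simp [ENNReal.zero_rpow_of_pos hb]
    have h : ENNReal.ofReal (l (a • x + b • y))
        = ENNReal.ofReal a * ENNReal.ofReal (l x) + ENNReal.ofReal b * ENNReal.ofReal (l y) := by
      rw [← ENNReal.ofReal_mul ha.le, ← ENNReal.ofReal_mul hb.le,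
        ← ENNReal.ofReal_add (by positivity) (by positivity)]
      simp
    rw [h]
    have e : ∀ (z : ℝ≥0∞) (c : ℝ), (z ^ 2) ^ c = (z ^ c) ^ 2 := by
      intro z c
      rw [← ENNReal.rpow_natCast, ← ENNReal.rpow_natCast, ← ENNReal.rpow_mul, ← ENNReal.rpow_mul,
        mul_comm]
    rw [e, e, ← mul_pow]
    gcongr
    exact ennreal_amgm ha hb hab _ _


theorem affine_of_additive {φ : ℝ → ℝ} (hm : ∀ a b, 0 ≤ a → a ≤ b → φ a ≤ φ b)
    (hadd : ∀ a b, 0 ≤ a → 0 ≤ b → φ (a + b) = φ a + φ b - φ 0) (a : ℝ) (ha : 0 ≤ a) :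
    φ a = φ 0 + a * (φ 1 - φ 0) := by
  have hn : ∀ (k : ℕ) (x : ℝ), 0 ≤ x → φ (k * x) - φ 0 = k * (φ x - φ 0) := by
    intro k x hx
    induction k with
    | zero => simp
    | succ k ih =>
      have := hadd (k * x) x (by positivity) hx
      push_cast
      rw [add_mul, one_mul, this]
      linarith
  have h1 : 0 ≤ φ 1 - φ 0 := by have := hm 0 1 le_rfl zero_le_one; linarith
  have key : ∀ N : ℕ, |(N : ℝ) * ((φ a - φ 0) - a * (φ 1 - φ 0))| ≤ φ 1 - φ 0 := by
    intro N
    have e1 := hn N a ha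
    have hNa : (0 : ℝ) ≤ N * a := by positivity
    have f1 := Nat.floor_le hNa
    have f2 := (Nat.lt_floor_add_one ((N : ℝ) * a)).le
    have g1 := hn ⌊(N : ℝ) * a⌋₊ 1 zero_le_one
    have g2 := hn (⌊(N : ℝ) * a⌋₊ + 1) 1 zero_le_one
    push_cast at g2
    rw [mul_one] at g1 g2
    have m1 := hm _ _ (Nat.cast_nonneg _) f1
    have m2 := hm _ _ hNa f2
    have t1 : (⌊(N : ℝ) * a⌋₊ : ℝ) * (φ 1 - φ 0) ≤ N * a * (φ 1 - φ 0) := by gcongr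
    have t2 : N * a * (φ 1 - φ 0) ≤ (⌊(N : ℝ) * a⌋₊ + 1 : ℝ) * (φ 1 - φ 0) := by gcongr
    rw [abs_le]
    constructor <;> nlinarith
  by_contra hne
  have hpos : 0 < |(φ a - φ 0) - a * (φ 1 - φ 0)| := by
    rw [abs_pos]; intro h; apply hne; linarith
  obtain ⟨N, hN⟩ := exists_nat_gt ((φ 1 - φ 0) / |(φ a - φ 0) - a * (φ 1 - φ 0)|)
  have := key N
  rw [abs_mul, Nat.abs_cast] at this
  rw [div_lt_iff₀ hpos] at hN
  linarith

/-- segment from `0` to `a • v` -/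
def segv {n : ℕ} (v : EuclideanSpace ℝ (Fin n)) (a : ℝ) : Set (EuclideanSpace ℝ (Fin n)) :=
  (fun t : ℝ => t • v) '' Icc 0 a

theorem segv_convex {n : ℕ} (v : EuclideanSpace ℝ (Fin n)) (a : ℝ) : Convex ℝ (segv v a) := by
  have := (convex_Icc (0:ℝ) a).linear_image (LinearMap.toSpanSingleton ℝ _ v)
  exact this

theorem segv_compact {n : ℕ} (v : EuclideanSpace ℝ (Fin n)) (a : ℝ) : IsCompact (segv v a) :=
  isCompact_Icc.image (by fun_prop)

theorem segv_zero {n : ℕ} (v : EuclideanSpace ℝ (Fin n)) : segv v 0 = {0} := by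
  simp [segv]

theorem segv_vol_add {n : ℕ} {K : Set (EuclideanSpace ℝ (Fin n))} (hK : Convex ℝ K)
    (hb : IsBounded K) (v : EuclideanSpace ℝ (Fin n)) (a b : ℝ) (ha : 0 ≤ a) (hb0 : 0 ≤ b) :
    volume.real (K + segv v (a + b)) = volume.real (K + segv v a) + volume.real (K + segv v b)
      - volume.real (K + segv v 0) := by
  have hU : K + segv v (a + b) = (K + segv v a) ∪ (a • v +ᵥ (K + segv v b)) := by
    ext x
    constructor
    · rintro ⟨k, hk, _, ⟨t, ht, rfl⟩, rfl⟩
      by_cases hta : t ≤ a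
      · left
        exact ⟨k, hk, _, ⟨t, ⟨ht.1, hta⟩, rfl⟩, rfl⟩
      · right
        refine ⟨k + (t - a) • v, ⟨k, hk, _, ⟨t - a, ⟨by linarith, by linarith [ht.2]⟩, rfl⟩, rfl⟩, ?_⟩
        simp only [vadd_eq_add]
        module
    · rintro (⟨k, hk, _, ⟨t, ht, rfl⟩, rfl⟩ | ⟨_, ⟨k, hk, _, ⟨t, ht, rfl⟩, rfl⟩, rfl⟩)
      · exact ⟨k, hk, _, ⟨t, ⟨ht.1, by linarith [ht.2]⟩, rfl⟩, rfl⟩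
      · refine ⟨k, hk, _, ⟨t + a, ⟨by linarith [ht.1], by linarith [ht.2]⟩, rfl⟩, ?_⟩
        simp only [vadd_eq_add]
        module
  have hI : (K + segv v a) ∩ (a • v +ᵥ (K + segv v b)) = a • v +ᵥ K := by
    ext x
    constructor
    · rintro ⟨⟨k, hk, _, ⟨t, ht, rfl⟩, rfl⟩, ⟨_, ⟨k', hk', _, ⟨s, hs, rfl⟩, rfl⟩, h⟩⟩
      simp only [vadd_eq_add] at h
      have h' : k' = k + (t - a - s) • v := by
        have : k' = (a • v + (k' + s • v)) - (a + s) • v := by module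
        rw [this, h]; module
      refine ⟨k + (t - a) • v, ?_, by simp only [vadd_eq_add]; module⟩
      rcases eq_or_lt_of_le (show 0 ≤ a - t + s by linarith [ht.2, hs.1]) with h0 | h0
      · have : t - a = 0 := by linarith [ht.2, hs.1]
        rw [this]; simpa using hk
      · have := hK hk hk' (show 0 ≤ s / (a - t + s) from div_nonneg hs.1 h0.le)
          (show 0 ≤ (a - t) / (a - t + s) from div_nonneg (by linarith [ht.2]) h0.le)
          (by field_simp; ring)
        convert this using 1
        rw [h']
        have e : (a - t) / (a - t + s) * (t - a - s) = t - a := by field_simp; ring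
        have e2 : s / (a - t + s) + (a - t) / (a - t + s) = 1 := by field_simp; ring
        rw [smul_add, smul_smul, e, ← add_assoc, ← add_smul, e2, one_smul]
    · rintro ⟨k, hk, rfl⟩
      refine ⟨⟨k, hk, _, ⟨a, ⟨ha, le_rfl⟩, rfl⟩, ?_⟩, ⟨k, ⟨k, hk, _, ⟨0, ⟨le_rfl, hb0⟩, rfl⟩, by simp⟩, rfl⟩⟩
      simp [add_comm]
  have hfin : ∀ c, IsBounded (K + segv v c) := fun c => hb.add (segv_compact v c).isBounded
  have hm : NullMeasurableSet (a • v +ᵥ (K + segv v b)) volume :=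
    ((hK.add (segv_convex v b)).vadd _).nullMeasurableSet volume
  have hv : ∀ S : Set (EuclideanSpace ℝ (Fin n)), volume.real (a • v +ᵥ S) = volume.real S := by
    intro S; simp [Measure.real, measure_vadd]
  have := measureReal_union_add_inter₀ (μ := volume) (s := K + segv v a) hm
    (h₁ := (hfin a).measure_lt_top.ne) (h₂ := ((hfin b).vadd _).measure_lt_top.ne)
  rw [← hU, hI, hv, hv] at this
  rw [segv_zero]
  simp only [add_singleton, add_zero, image_id']
  linarith

theorem segv_vol_affine {n : ℕ} {K : Set (EuclideanSpace ℝ (Fin n))} (hK : Convex ℝ K)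
    (hb : IsBounded K) (v : EuclideanSpace ℝ (Fin n)) (a : ℝ) (ha : 0 ≤ a) :
    volume.real (K + segv v a) = volume.real K + a * (volume.real (K + segv v 1) - volume.real K) := by
  have := affine_of_additive (φ := fun a => volume.real (K + segv v a)) ?_
    (segv_vol_add hK hb v) a ha
  · simpa [segv_zero] using this
  · intro a b ha hab
    refine measureReal_mono (add_subset_add_left (image_mono (Icc_subset_Icc_right hab)))
      (hb.add (segv_compact v b).isBounded).measure_lt_top.ne

def zono {n : ℕ} : List (EuclideanSpace ℝ (Fin n)) → ℝ → Set (EuclideanSpace ℝ (Fin n))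
  | [], _ => {0}
  | v :: l, s => segv v s + zono l s

theorem zono_convex {n : ℕ} (l : List (EuclideanSpace ℝ (Fin n))) (s : ℝ) : Convex ℝ (zono l s) := by
  induction l with
  | nil => exact convex_singleton _
  | cons v l ih => exact (segv_convex v s).add ih

theorem zono_compact {n : ℕ} (l : List (EuclideanSpace ℝ (Fin n))) (s : ℝ) : IsCompact (zono l s) := by
  induction l with
  | nil => exact isCompact_singleton
  | cons v l ih => exact (segv_compact v s).add ih

theorem segv_smul {n : ℕ} (v : EuclideanSpace ℝ (Fin n)) (s : ℝ) (hs : 0 ≤ s) :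
    segv v s = s • segv v 1 := by
  ext x
  constructor
  · rintro ⟨t, ht, rfl⟩
    rcases hs.eq_or_lt with h | h
    · subst h
      have : t = 0 := le_antisymm ht.2 ht.1
      exact ⟨0, ⟨0, by simp, by simp⟩, by simp [this]⟩
    · refine ⟨(t / s) • v, ⟨t / s, ⟨by have := ht.1; positivity, by rw [div_le_one h]; exact ht.2⟩, rfl⟩, ?_⟩
      simp only [smul_smul]; congr 1; field_simp
  · rintro ⟨_, ⟨t, ht, rfl⟩, rfl⟩
    exact ⟨s * t, ⟨by have := ht.1; positivity, by nlinarith [ht.2]⟩, by simp [smul_smul]⟩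

theorem zono_smul {n : ℕ} (l : List (EuclideanSpace ℝ (Fin n))) (s : ℝ) (hs : 0 ≤ s) :
    zono l s = s • zono l 1 := by
  induction l with
  | nil => simp [zono]
  | cons v l ih => simp only [zono]; rw [smul_add, segv_smul v s hs, ih]

theorem zono_poly {n : ℕ} (l : List (EuclideanSpace ℝ (Fin n))) :
    ∀ K : Set (EuclideanSpace ℝ (Fin n)), Convex ℝ K → IsBounded K →
      ∃ P : Polynomial ℝ, ∀ s, 0 ≤ s → volume.real (K + zono l s) = P.eval s := by
  induction l with
  | nil =>
    intro K _ _
    exact ⟨Polynomial.C (volume.real K), fun s _ => by simp [zono]⟩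
  | cons v l ih =>
    intro K hK hb
    obtain ⟨P, hP⟩ := ih K hK hb
    obtain ⟨Q, hQ⟩ := ih (K + segv v 1) (hK.add (segv_convex v 1)) (hb.add (segv_compact v 1).isBounded)
    refine ⟨P + Polynomial.X * (Q - P), fun s hs => ?_⟩
    have := segv_vol_affine (hK.add (zono_convex l s)) (hb.add (zono_compact l s).isBounded) v s hs
    simp only [zono]
    rw [add_comm (segv v s), ← add_assoc, this, hP s hs, add_right_comm, hQ s hs]
    simp


/-- support function of a zonotope -/
noncomputable def zsupp {n : ℕ} (l : List (EuclideanSpace ℝ (Fin n))) (x : EuclideanSpace ℝ (Fin n)) : ℝ :=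
  (l.map (fun v => max (inner ℝ v x) 0)).sum

theorem zsupp_le {n : ℕ} (l : List (EuclideanSpace ℝ (Fin n))) (x : EuclideanSpace ℝ (Fin n)) :
    ∀ z ∈ zono l 1, inner ℝ z x ≤ zsupp l x := by
  induction l with
  | nil => intro z hz; simp [zono] at hz; simp [hz, zsupp]
  | cons v l ih =>
    rintro _ ⟨_, ⟨t, ht, rfl⟩, z, hz, rfl⟩
    have := ih z hz
    simp only [zsupp, List.map_cons, List.sum_cons, inner_add_left, real_inner_smul_left] at this ⊢
    have : t * inner ℝ v x ≤ max (inner ℝ v x) 0 := by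
      rcases le_total 0 (inner ℝ v x) with h | h
      · exact le_max_of_le_left (by nlinarith [ht.2])
      · exact le_max_of_le_right (by nlinarith [ht.1])
    linarith

theorem zsupp_attained {n : ℕ} (l : List (EuclideanSpace ℝ (Fin n))) (x : EuclideanSpace ℝ (Fin n)) :
    ∃ z ∈ zono l 1, inner ℝ z x = zsupp l x := by
  induction l with
  | nil => exact ⟨0, by simp [zono], by simp [zsupp]⟩
  | cons v l ih =>
    obtain ⟨z, hz, h⟩ := ih
    rcases le_total 0 (inner ℝ v x) with h0 | h0
    · refine ⟨(1:ℝ) • v + z, ⟨_, ⟨1, by simp, rfl⟩, z, hz, rfl⟩, ?_⟩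
      simp [inner_add_left, zsupp, max_eq_left h0] at h ⊢
      exact h
    · refine ⟨(0:ℝ) • v + z, ⟨_, ⟨0, by simp, rfl⟩, z, hz, rfl⟩, ?_⟩
      simp [zsupp, max_eq_right h0] at h ⊢
      exact h

theorem zsupp_smul {n : ℕ} (l : List (EuclideanSpace ℝ (Fin n))) (x : EuclideanSpace ℝ (Fin n))
    (a : ℝ) (ha : 0 ≤ a) : zsupp l (a • x) = a * zsupp l x := by
  induction l with
  | nil => simp [zsupp]
  | cons v l ih =>
    simp only [zsupp, List.map_cons, List.sum_cons, real_inner_smul_right] at ih ⊢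
    rw [ih, mul_add, mul_max_of_nonneg _ _ ha, mul_zero]

theorem zsupp_smul_list {n : ℕ} (l : List (EuclideanSpace ℝ (Fin n))) (x : EuclideanSpace ℝ (Fin n))
    (a : ℝ) (ha : 0 ≤ a) : zsupp (l.map (fun v => a • v)) x = a * zsupp l x := by
  induction l with
  | nil => simp [zsupp]
  | cons v l ih =>
    simp only [zsupp, List.map_cons, List.sum_cons, real_inner_smul_left] at ih ⊢
    rw [ih, mul_add, mul_max_of_nonneg _ _ ha, mul_zero]

theorem zsupp_append {n : ℕ} (l l' : List (EuclideanSpace ℝ (Fin n))) (x : EuclideanSpace ℝ (Fin n)) :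
    zsupp (l ++ l') x = zsupp l x + zsupp l' x := by
  simp [zsupp]

theorem avg_support {n : ℕ} (hn : 0 < n) : ∃ c : ℝ, 0 < c ∧ ∀ x : EuclideanSpace ℝ (Fin n),
    (⨍ y in closedBall (0 : EuclideanSpace ℝ (Fin n)) 1, max (inner ℝ y x) 0) = c * ‖x‖ := by
  set V := EuclideanSpace ℝ (Fin n) with hV
  set B := closedBall (0 : V) 1 with hB
  have : Nonempty (Fin n) := ⟨⟨0, hn⟩⟩
  have : Nontrivial V := inferInstance
  set g : V → ℝ := fun x => ∫ y in B, max (inner ℝ y x) 0 with hg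
  have hinv : ∀ (T : V ≃ₗᵢ[ℝ] V) (x : V), g (T x) = g x := by
    intro T x
    have hmp := T.measurePreserving
    have hpre : T ⁻¹' B = B := by ext y; simp [hB]
    have := hmp.setIntegral_preimage_emb T.toHomeomorph.measurableEmbedding
      (fun y => max (inner ℝ y (T x)) 0) B
    simp only [hg]
    rw [← this, hpre]
    simp
  have hhom : ∀ (a : ℝ) (x : V), 0 ≤ a → g (a • x) = a * g x := by
    intro a x ha
    simp only [hg]
    rw [← integral_const_mul]
    congr 1; ext y
    rw [real_inner_smul_right, mul_max_of_nonneg _ _ ha, mul_zero]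
  obtain ⟨e, he⟩ := exists_norm_eq V (zero_le_one (α := ℝ))
  have hge : ∀ x : V, g x = g e * ‖x‖ := by
    intro x
    rcases eq_or_ne x 0 with h | h
    · simp [h, hg]
    · have hx : 0 < ‖x‖ := norm_pos_iff.2 h
      have hnorm : ‖(‖x‖⁻¹ • x)‖ = 1 := by rw [norm_smul, norm_inv, norm_norm]; field_simp
      have h1 : g (‖x‖⁻¹ • x) = g e := by
        have := Submodule.reflection_sub (v := e) (w := ‖x‖⁻¹ • x) (by rw [he, hnorm])
        rw [← this, hinv]
      rw [← h1, hhom _ _ (by positivity)]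
      field_simp
  have hpos : 0 < g e := by
    simp only [hg]
    have hc : Continuous (fun y : V => max (inner ℝ y e) 0) := by fun_prop
    rw [setIntegral_pos_iff_support_of_nonneg_ae]
    · have : (ball (0:V) 1 ∩ {y | 0 < inner ℝ y e}) ⊆ (Function.support fun y : V => max (inner ℝ y e) 0) ∩ B := by
        rintro y ⟨h1, h2⟩
        refine ⟨?_, ball_subset_closedBall h1⟩
        simp only [Function.mem_support]
        have : 0 < inner ℝ y e := h2
        exact (lt_max_of_lt_left this).ne'
      refine lt_of_lt_of_le ?_ (measure_mono this)
      refine IsOpen.measure_pos _ (isOpen_ball.inter (isOpen_lt continuous_const (by fun_prop))) ?_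
      refine ⟨(1/2:ℝ) • e, ?_, ?_⟩
      · simp [norm_smul, he]; norm_num
      · simp [real_inner_smul_left, he]
    · exact Eventually.of_forall fun y => le_max_right _ _
    · exact hc.continuousOn.integrableOn_compact (isCompact_closedBall _ _)
  have hvol : 0 < volume.real B :=
    ENNReal.toReal_pos (measure_closedBall_pos _ _ zero_lt_one).ne' measure_closedBall_lt_top.ne
  refine ⟨(volume.real B)⁻¹ * g e, by positivity, fun x => ?_⟩
  rw [setAverage_eq, mul_assoc, ← hge, smul_eq_mul]

theorem zono_approx {n : ℕ} (hn : 0 < n) : ∃ c : ℝ, 0 < c ∧ ∀ ε > 0, ∃ l : List (EuclideanSpace ℝ (Fin n)),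
    ∀ x, |zsupp l x - c * ‖x‖| ≤ ε * ‖x‖ := by
  obtain ⟨c, hc, havg⟩ := avg_support hn
  refine ⟨c, hc, fun ε hε => ?_⟩
  set V := EuclideanSpace ℝ (Fin n) with hV
  let B := closedBall (0 : V) 1
  have : CompactSpace B := isCompact_iff_compactSpace.1 (isCompact_closedBall _ _)
  let F : C(V × B, ℝ) := ⟨fun p => max (inner ℝ p.1 (p.2 : V)) 0, by fun_prop⟩
  let f : C(V, C(B, ℝ)) := F.curry
  let S : Set C(B, ℝ) := {h | ∃ l : List V, ∀ x : B, h x = zsupp l x}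
  have hS : Convex ℝ S := by
    rintro h ⟨l, hl⟩ h' ⟨l', hl'⟩ a b ha hb _
    refine ⟨l.map (fun v => a • v) ++ l'.map (fun v => b • v), fun x => ?_⟩
    rw [zsupp_append, zsupp_smul_list _ _ _ ha, zsupp_smul_list _ _ _ hb]
    simp [hl, hl']
  have hfS : ∀ y, f y ∈ S := fun y => ⟨[y], fun x => by simp [zsupp, f, F]⟩
  have hintg : IntegrableOn f B volume := f.continuous.continuousOn.integrableOn_compact (isCompact_closedBall _ _)
  have hmem : (⨍ y in B, f y) ∈ closure S := by
    refine hS.closure.set_average_mem isClosed_closure (measure_closedBall_pos _ _ zero_lt_one).ne'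
      measure_closedBall_lt_top.ne (Eventually.of_forall fun y => subset_closure (hfS y)) hintg
  rw [Metric.mem_closure_iff] at hmem
  obtain ⟨h, ⟨l, hl⟩, hd⟩ := hmem ε hε
  refine ⟨l, fun x => ?_⟩
  have hev : ∀ x : B, (⨍ y in B, f y) x = c * ‖(x : V)‖ := by
    intro x
    rw [← havg, setAverage_eq, setAverage_eq]
    rw [ContinuousMap.smul_apply, ContinuousMap.integral_apply hintg]
    rfl
  rcases eq_or_ne x 0 with h0 | h0
  · have := zsupp_smul l 0 0 le_rfl
    simp at this
    simp [h0, this]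
  · have hx : 0 < ‖x‖ := norm_pos_iff.2 h0
    have hnorm : ‖(‖x‖⁻¹ • x)‖ = 1 := by rw [norm_smul, norm_inv, norm_norm]; field_simp
    let u : B := ⟨‖x‖⁻¹ • x, by simp only [B, mem_closedBall_zero_iff]; exact hnorm.le⟩
    have h1 := ContinuousMap.dist_apply_le_dist (f := ⨍ y in B, f y) (g := h) u
    rw [hev u, hl u] at h1
    have hu : (u : V) = ‖x‖⁻¹ • x := rfl
    rw [hu, hnorm, zsupp_smul _ _ _ (by positivity), Real.dist_eq, abs_sub_comm] at h1
    have h2 : zsupp l x - c * ‖x‖ = ‖x‖ * (‖x‖⁻¹ * zsupp l x - c * 1) := by field_simp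
    rw [h2, abs_mul, abs_norm, mul_comm]
    gcongr
    linarith

theorem zono_sandwich {n : ℕ} (hn : 0 < n) (ε : ℝ) (hε : 0 < ε) (hε1 : ε < 1) :
    ∃ l : List (EuclideanSpace ℝ (Fin n)),
      closedBall 0 (1 - ε) ⊆ zono l 1 ∧ zono l 1 ⊆ closedBall 0 (1 + ε) := by
  obtain ⟨c, hc, h⟩ := zono_approx hn
  obtain ⟨l0, hl0⟩ := h (ε * c) (by positivity)
  set l := l0.map (fun v => c⁻¹ • v) with hldef
  have hl : ∀ x, |zsupp l x - ‖x‖| ≤ ε * ‖x‖ := by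
    intro x
    have := hl0 x
    rw [hldef, zsupp_smul_list _ _ _ (by positivity)]
    have h2 : c⁻¹ * zsupp l0 x - ‖x‖ = c⁻¹ * (zsupp l0 x - c * ‖x‖) := by field_simp
    rw [h2, abs_mul, abs_of_pos (inv_pos.2 hc), inv_mul_le_iff₀ hc]
    linarith
  refine ⟨l, ?_, ?_⟩
  · intro y hy
    by_contra hyn
    obtain ⟨f, u, hf1, hf2⟩ := geometric_hahn_banach_closed_point (zono_convex l 1)
      (zono_compact l 1).isClosed hyn
    set w := (InnerProductSpace.toDual ℝ (EuclideanSpace ℝ (Fin n))).symm f with hw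
    have hfw : ∀ z, f z = inner ℝ z w := by
      intro z; rw [real_inner_comm]; simp [hw]
    obtain ⟨z, hz, hzw⟩ := zsupp_attained l w
    have h1 := hf1 z hz
    rw [hfw, hzw] at h1
    rw [hfw] at hf2
    have h3 := real_inner_le_norm y w
    rw [mem_closedBall_zero_iff] at hy
    have h4 := (abs_le.1 (hl w)).1
    nlinarith [norm_nonneg w]
  · intro z hz
    rw [mem_closedBall_zero_iff]
    have h1 := zsupp_le l z z hz
    rw [real_inner_self_eq_norm_sq] at h1
    have h2 := (abs_le.1 (hl z)).2
    by_contra hc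
    push Not at hc
    nlinarith [norm_nonneg z]


theorem real_smul_vol {n : ℕ} (A : Set (EuclideanSpace ℝ (Fin n))) {c : ℝ} (hc : 0 ≤ c) :
    volume.real (c • A) = c ^ n * volume.real A := by
  rw [Measure.real, Measure.addHaar_smul, ENNReal.toReal_mul, ENNReal.toReal_ofReal (abs_nonneg _)]
  simp [abs_of_nonneg hc, Measure.real]

theorem closedBall_smul_one {n : ℕ} {s : ℝ} (hs : 0 ≤ s) :
    s • closedBall (0 : EuclideanSpace ℝ (Fin n)) 1 = closedBall 0 s := by
  rw [smul_unitClosedBall, Real.norm_of_nonneg hs]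

theorem steiner_approx {n : ℕ} (hn : 0 < n) {K : Set (EuclideanSpace ℝ (Fin n))} (hK : Convex ℝ K)
    (hb : IsBounded K) (h0 : (0 : EuclideanSpace ℝ (Fin n)) ∈ K) (ε : ℝ) (hε : 0 < ε) (hε1 : ε < 1) :
    ∃ P : Polynomial ℝ, P.degree < (n + 1 : ℕ) ∧ ∀ s, 0 ≤ s →
      (1 - ε) ^ n * volume.real (K + closedBall 0 s) ≤ P.eval s ∧
      P.eval s ≤ (1 + ε) ^ n * volume.real (K + closedBall 0 s) := by
  obtain ⟨l, hl1, hl2⟩ := zono_sandwich hn ε hε hε1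
  obtain ⟨P, hP⟩ := zono_poly l K hK hb
  have hbd : ∀ s, IsBounded (K + closedBall (0 : EuclideanSpace ℝ (Fin n)) s) :=
    fun s => hb.add isBounded_closedBall
  have main : ∀ s, 0 ≤ s →
      (1 - ε) ^ n * volume.real (K + closedBall 0 s) ≤ P.eval s ∧
      P.eval s ≤ (1 + ε) ^ n * volume.real (K + closedBall 0 s) := by
    intro s hs
    rw [← hP s hs, zono_smul l s hs, ← real_smul_vol _ (by linarith), ← real_smul_vol _ (by linarith)]
    constructor
    · refine measureReal_mono ?_ (hb.add (((zono_compact l 1).smul s).isBounded)).measure_lt_top.ne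
      rw [smul_add]
      refine add_subset_add ?_ ?_
      · rintro _ ⟨k, hk, rfl⟩
        exact hK.smul_mem_of_zero_mem h0 hk ⟨by linarith, by linarith⟩
      · rw [← closedBall_smul_one hs, smul_comm, closedBall_smul_one (by linarith)]
        exact smul_set_mono hl1
    · refine measureReal_mono ?_ ((hbd s).smul₀ _).measure_lt_top.ne
      rw [smul_add]
      refine add_subset_add ?_ ?_
      · intro k hk
        refine ⟨(1 + ε)⁻¹ • k, hK.smul_mem_of_zero_mem h0 hk ⟨by positivity, inv_le_one_of_one_le₀ (by linarith)⟩, ?_⟩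
        exact smul_inv_smul₀ (show (1 + ε) ≠ 0 by linarith) k
      · rw [← closedBall_smul_one hs, smul_comm, closedBall_smul_one (by linarith)]
        exact smul_set_mono hl2
  refine ⟨P, ?_, main⟩
  by_contra hdeg
  push Not at hdeg
  obtain ⟨D, hD0, hD⟩ := hb.subset_closedBall_lt 0 0
  set Q : Polynomial ℝ := (Polynomial.X + Polynomial.C D) ^ n with hQ
  have hQdeg : Q.degree = n := by
    rw [hQ, Polynomial.degree_pow, Polynomial.degree_X_add_C]; simp
  have hQ0 : Q ≠ 0 := by rw [hQ]; exact pow_ne_zero _ (Polynomial.X_add_C_ne_zero D)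
  have hlim := Polynomial.abs_div_tendsto_atTop_atTop_of_degree_gt P Q (by
    rw [hQdeg]; refine lt_of_lt_of_le ?_ hdeg; exact_mod_cast Nat.lt_succ_self n) hQ0
  obtain ⟨s, hs1, hs0⟩ := ((hlim.eventually_gt_atTop
    ((1 + ε) ^ n * volume.real (closedBall (0 : EuclideanSpace ℝ (Fin n)) 1))).and
    (eventually_ge_atTop 0)).exists
  have h1 := (main s hs0).2
  have h2 : 0 ≤ P.eval s := le_trans (mul_nonneg (pow_nonneg (by linarith) _) measureReal_nonneg) (main s hs0).1
  have h3 : volume.real (K + closedBall 0 s) ≤ (s + D) ^ n * volume.real (closedBall (0 : EuclideanSpace ℝ (Fin n)) 1) := by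
    rw [← real_smul_vol _ (by linarith), closedBall_smul_one (by linarith)]
    refine measureReal_mono ?_ measure_closedBall_lt_top.ne
    refine (add_subset_add_right hD).trans ?_
    rw [closedBall_add_closedBall hD0.le hs0, add_zero, add_comm]
  have hQe : Q.eval s = (s + D) ^ n := by simp [hQ]
  have hQp : 0 < (s + D) ^ n := by positivity
  rw [hQe, abs_of_nonneg (by positivity), lt_div_iff₀ hQp] at hs1
  have h4 : (1 + ε) ^ n * volume.real (K + closedBall 0 s) ≤
    (1 + ε) ^ n * ((s + D) ^ n * volume.real (closedBall (0 : EuclideanSpace ℝ (Fin n)) 1)) := by gcongr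
  nlinarith

theorem steiner_poly {n : ℕ} (hn : 0 < n) {K : Set (EuclideanSpace ℝ (Fin n))} (hK : Convex ℝ K)
    (hb : IsBounded K) (h0 : (0 : EuclideanSpace ℝ (Fin n)) ∈ K) :
    ∃ P : Polynomial ℝ, P.degree < (n + 1 : ℕ) ∧ ∀ s, 0 ≤ s →
      volume.real (K + closedBall 0 s) = P.eval s := by
  set g : ℝ → ℝ := fun s => volume.real (K + closedBall 0 s) with hg
  let ε : ℕ → ℝ := fun k => 1 / ((k : ℝ) + 1 + 1)
  have hε : ∀ k, 0 < ε k := fun k => by positivity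
  have hε1 : ∀ k, ε k < 1 := fun k => by
    simp only [ε]; rw [div_lt_one (by positivity)]; have : (0:ℝ) ≤ k := k.cast_nonneg; linarith
  have hεlim : Tendsto ε atTop (nhds 0) := by
    have := (tendsto_one_div_add_atTop_nhds_zero_nat (𝕜 := ℝ)).comp (tendsto_add_atTop_nat 1)
    refine this.congr fun k => ?_
    simp [ε]
  choose P hPd hP using fun k => steiner_approx hn hK hb h0 (ε k) (hε k) (hε1 k)
  have hconv : ∀ s, 0 ≤ s → Tendsto (fun k => (P k).eval s) atTop (nhds (g s)) := by
    intro s hs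
    refine tendsto_of_tendsto_of_tendsto_of_le_of_le ?_ ?_ (fun k => (hP k s hs).1) (fun k => (hP k s hs).2)
    · have := ((tendsto_const_nhds (x := (1:ℝ))).sub hεlim).pow n |>.mul_const (g s)
      simpa using this
    · have := ((tendsto_const_nhds (x := (1:ℝ))).add hεlim).pow n |>.mul_const (g s)
      simpa using this
  let v : ℕ → ℝ := fun i => i
  have hv : Set.InjOn v (Finset.range (n + 1)) := fun a _ b _ h => by simpa [v] using h
  refine ⟨Lagrange.interpolate (Finset.range (n + 1)) v (fun i => g (v i)), ?_, ?_⟩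
  · have := Lagrange.degree_interpolate_lt (s := Finset.range (n+1)) (v := v) (fun i => g (v i)) hv
    simpa using this
  · intro s hs
    have h1 : ∀ k, (P k).eval s = (Lagrange.interpolate (Finset.range (n + 1)) v (fun i => (P k).eval (v i))).eval s := by
      intro k
      rw [← Lagrange.eq_interpolate hv (by simpa using hPd k)]
    refine tendsto_nhds_unique (hconv s hs) ?_
    simp_rw [h1, Lagrange.interpolate_apply, Polynomial.eval_finsetSum, Polynomial.eval_mul, Polynomial.eval_C]
    refine tendsto_finsetSum _ fun i _ => ?_
    exact (hconv (v i) (by simp [v])).mul_const _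


theorem steiner_poly' {n : ℕ} (hn : 0 < n) {K : Set (EuclideanSpace ℝ (Fin n))} (hK : Convex ℝ K)
    (hb : IsBounded K) (h0 : K.Nonempty) :
    ∃ P : Polynomial ℝ, P.degree < (n + 1 : ℕ) ∧ ∀ s, 0 ≤ s →
      volume.real (K + closedBall 0 s) = P.eval s := by
  obtain ⟨x, hx⟩ := h0
  obtain ⟨P, hP, h⟩ := steiner_poly hn (hK.vadd (-x)) (hb.vadd (-x)) ⟨x, hx, by simp⟩
  refine ⟨P, hP, fun s hs => ?_⟩
  rw [← h s hs, vadd_add_assoc]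
  simp [Measure.real, measure_vadd]

theorem pow_gap_mono (n : ℕ) {x y h : ℝ} (hx : 0 ≤ x) (hxy : x ≤ y) (hh : 0 ≤ h) :
    (x + h) ^ n - x ^ n ≤ (y + h) ^ n - y ^ n := by
  induction n with
  | zero => simp
  | succ n ih =>
    have e : ∀ z : ℝ, (z + h) ^ (n + 1) - z ^ (n + 1) = (z + h) * ((z + h) ^ n - z ^ n) + h * z ^ n := by
      intro z; ring
    rw [e, e]
    have h1 : 0 ≤ (x + h) ^ n - x ^ n := by
      have := pow_le_pow_left₀ hx (show x ≤ x + h by linarith) n; linarith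
    have hy : 0 ≤ y := hx.trans hxy
    gcongr

theorem bm_real {n : ℕ} (_hn : 0 < n) {A B : Set (EuclideanSpace ℝ (Fin n))}
    (hA : Convex ℝ A) (hB : Convex ℝ B) (bA : IsBounded A) (bB : IsBounded B) {a b : ℝ} (ha : 0 < a) (hb : 0 < b)
    (h1 : a ^ n ≤ volume.real A) (h2 : b ^ n ≤ volume.real B) :
    (a + b) ^ n ≤ volume.real (A + B) := by
  have := bm_convex hA hB ha hb
    ((ENNReal.ofReal_le_iff_le_toReal bA.measure_lt_top.ne).2 h1)
    ((ENNReal.ofReal_le_iff_le_toReal bB.measure_lt_top.ne).2 h2)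
  exact (ENNReal.ofReal_le_iff_le_toReal (bA.add bB).measure_lt_top.ne).1 this

theorem poly_growth {P : Polynomial ℝ} {n : ℕ} (hn : 0 < n) (hP : P.degree < n) :
    ∃ C : ℝ, 0 ≤ C ∧ ∀ s : ℝ, 1 ≤ s → |P.eval s| ≤ C * s ^ (n - 1) := by
  have hnat : P.natDegree < n := by
    rcases eq_or_ne P 0 with h | h
    · simpa [h] using hn
    · exact (Polynomial.natDegree_lt_iff_degree_lt h).2 hP
  refine ⟨∑ i ∈ Finset.range n, |P.coeff i|, Finset.sum_nonneg fun _ _ => abs_nonneg _, fun s hs => ?_⟩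
  rw [Polynomial.eval_eq_sum_range' hnat, Finset.sum_mul]
  refine (Finset.abs_sum_le_sum_abs _ _).trans (Finset.sum_le_sum fun i hi => ?_)
  rw [abs_mul, abs_pow, abs_of_nonneg (by linarith : (0:ℝ) ≤ s)]
  have : i ≤ n - 1 := by have := Finset.mem_range.1 hi; omega
  gcongr

theorem real_closedBall_vol {n : ℕ} {s : ℝ} (hs : 0 ≤ s) :
    volume.real (closedBall (0 : EuclideanSpace ℝ (Fin n)) s) =
      volume.real (closedBall (0 : EuclideanSpace ℝ (Fin n)) 1) * s ^ n := by
  rw [← closedBall_smul_one hs, real_smul_vol _ hs, mul_comm]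

theorem omega_pos (n : ℕ) : 0 < volume.real (closedBall (0 : EuclideanSpace ℝ (Fin n)) 1) :=
  ENNReal.toReal_pos (measure_closedBall_pos _ _ zero_lt_one).ne' measure_closedBall_lt_top.ne

theorem deficit_range {n : ℕ} (hn : 0 < n) {K : Set (EuclideanSpace ℝ (Fin n))} (hK : Convex ℝ K)
    (hb : IsBounded K) {R : ℝ} (hR : 0 < R)
    (hvol : volume.real K = volume.real (closedBall (0 : EuclideanSpace ℝ (Fin n)) 1) * R ^ n)
    {s r : ℝ} (hs : 0 ≤ s) (hsr : s ≤ r) :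
    0 ≤ volume.real (K + closedBall 0 s)
        - volume.real (closedBall (0 : EuclideanSpace ℝ (Fin n)) 1) * (R + s) ^ n ∧
    volume.real (K + closedBall 0 s)
        - volume.real (closedBall (0 : EuclideanSpace ℝ (Fin n)) 1) * (R + s) ^ n ≤
    volume.real (K + closedBall 0 r)
        - volume.real (closedBall (0 : EuclideanSpace ℝ (Fin n)) 1) * (R + r) ^ n := by
  set ω := volume.real (closedBall (0 : EuclideanSpace ℝ (Fin n)) 1) with hω
  have hω0 : 0 < ω := omega_pos n
  have hn' : (n : ℝ) ≠ 0 := by positivity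
  set κ := ω ^ (n : ℝ)⁻¹ with hκ
  have hκ0 : 0 < κ := by positivity
  have hκn : κ ^ n = ω := by rw [hκ]; exact Real.rpow_inv_natCast_pow hω0.le hn.ne'
  have step1 : ∀ s, 0 ≤ s → ω * (R + s) ^ n ≤ volume.real (K + closedBall 0 s) := by
    intro s hs
    rcases hs.eq_or_lt with h | h
    · subst h; simp [hvol]
    · have := bm_real hn hK (convex_closedBall 0 s) hb isBounded_closedBall (mul_pos hκ0 hR) (mul_pos hκ0 h)
        (by rw [mul_pow, hκn, hvol]) (by rw [mul_pow, hκn, real_closedBall_vol h.le])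
      rwa [← mul_add, mul_pow, hκn] at this
  refine ⟨by have := step1 s hs; linarith, ?_⟩
  rcases hsr.eq_or_lt with h | h
  · rw [h]
  · have hV0 : 0 < volume.real (K + closedBall 0 s) := lt_of_lt_of_le (by positivity) (step1 s hs)
    set f := (volume.real (K + closedBall 0 s)) ^ (n : ℝ)⁻¹ with hf
    have hf0 : 0 < f := by positivity
    have hfn : f ^ n = volume.real (K + closedBall 0 s) := Real.rpow_inv_natCast_pow hV0.le hn.ne'
    have hbm := bm_real hn (hK.add (convex_closedBall 0 s)) (convex_closedBall 0 (r - s))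
      (hb.add isBounded_closedBall) isBounded_closedBall hf0 (mul_pos hκ0 (sub_pos.2 h)) hfn.le
      (by rw [mul_pow, hκn, real_closedBall_vol (by linarith)])
    rw [add_assoc, closedBall_add_closedBall hs (by linarith), add_zero, add_sub_cancel] at hbm
    have hfk : κ * (R + s) ≤ f := by
      have := step1 s hs
      rw [← hfn, ← hκn, ← mul_pow] at this
      exact le_of_pow_le_pow_left₀ hn.ne' hf0.le this
    have hgap := pow_gap_mono n (by positivity) hfk (h := κ * (r - s)) (mul_nonneg hκ0.le (by linarith))
    rw [← mul_add, mul_pow, mul_pow, hκn, hfn] at hgap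
    have : R + s + (r - s) = R + r := by ring
    rw [this] at hgap
    linarith

theorem deficit_growth {n : ℕ} (hn : 0 < n) {R r : ℝ} (hR : 0 < R) (hr : 0 < r) :
    ∃ C : ℝ, 0 ≤ C ∧ ∀ K : Set (EuclideanSpace ℝ (Fin n)), Convex ℝ K → IsBounded K →
    volume.real K = volume.real (closedBall (0 : EuclideanSpace ℝ (Fin n)) 1) * R ^ n →
    ∀ s, 1 ≤ s → 
    volume.real (K + closedBall 0 s)
        - volume.real (closedBall (0 : EuclideanSpace ℝ (Fin n)) 1) * (R + s) ^ n ≤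
    C * (volume.real (K + closedBall 0 r)
        - volume.real (closedBall (0 : EuclideanSpace ℝ (Fin n)) 1) * (R + r) ^ n) * s ^ (n - 1) := by
  set ω := volume.real (closedBall (0 : EuclideanSpace ℝ (Fin n)) 1) with hω
  have hω0 : 0 < ω := omega_pos n
  let v : ℕ → ℝ := fun i => r * (i / n)
  have hnR : (0 : ℝ) < n := by exact_mod_cast hn
  have hv : Set.InjOn v (Finset.range n) := by
    intro a _ b _ h
    simp only [v] at h
    have h2 := mul_left_cancel₀ hr.ne' h
    rw [div_left_inj' hnR.ne'] at h2
    exact_mod_cast h2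
  have hbasis : ∀ i ∈ Finset.range n, ∃ C : ℝ, 0 ≤ C ∧ ∀ s : ℝ, 1 ≤ s →
      |(Lagrange.basis (Finset.range n) v i).eval s| ≤ C * s ^ (n - 1) := by
    intro i hi
    refine poly_growth hn ?_
    rw [Lagrange.degree_basis hv hi, Finset.card_range]
    exact_mod_cast Nat.sub_lt hn one_pos
  choose! c hc0 hc using hbasis
  refine ⟨∑ i ∈ Finset.range n, c i, Finset.sum_nonneg hc0, ?_⟩
  intro K hK hb hvol s hs
  have hne : K.Nonempty := by
    rw [nonempty_iff_ne_empty]; rintro rfl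
    have : 0 < ω * R ^ n := by positivity
    simp at hvol; rcases hvol with h | h <;> [exact hω0.ne' h; exact hR.ne' h.1]
  obtain ⟨P, hPd, hP⟩ := steiner_poly' hn hK hb hne
  set Q : Polynomial ℝ := P - Polynomial.C ω * (Polynomial.X + Polynomial.C R) ^ n with hQ
  set δ := volume.real (K + closedBall 0 r) - ω * (R + r) ^ n with hδ
  have hQe : ∀ s, 0 ≤ s → Q.eval s = volume.real (K + closedBall 0 s) - ω * (R + s) ^ n := by
    intro s hs; simp [hQ, hP s hs, add_comm]
  have hQdeg : Q.degree < (n : WithBot ℕ) := by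
    obtain ⟨D, hD0, hD⟩ := hb.subset_closedBall_lt 0 0
    set T : Polynomial ℝ := Polynomial.C ω * ((Polynomial.X + Polynomial.C D) ^ n - (Polynomial.X + Polynomial.C R) ^ n) + Polynomial.C 1 with hT
    have hTe : ∀ s, T.eval s = ω * ((s + D) ^ n - (s + R) ^ n) + 1 := by intro s; simp [hT]
    have dX : ∀ a : ℝ, ((Polynomial.X + Polynomial.C a) ^ n).degree = (n : WithBot ℕ) := by
      intro a; rw [Polynomial.degree_pow, Polynomial.degree_X_add_C]; simp
    have hTd : T.degree < (n : WithBot ℕ) := by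
      refine (Polynomial.degree_add_le _ _).trans_lt (max_lt ?_ ?_)
      · rw [Polynomial.degree_C_mul hω0.ne', ← dX D]
        refine Polynomial.degree_sub_lt_left (by rw [dX, dX]) (pow_ne_zero _ (Polynomial.X_add_C_ne_zero D)) ?_
        rw [((Polynomial.monic_X_add_C D).pow n).leadingCoeff, ((Polynomial.monic_X_add_C R).pow n).leadingCoeff]
      · rw [Polynomial.degree_C one_ne_zero]; exact_mod_cast hn
    have hQT : ∀ s, 0 ≤ s → 0 ≤ Q.eval s ∧ Q.eval s + 1 ≤ T.eval s := by
      intro s hs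
      have h1 := (deficit_range hn hK hb hR hvol hs le_rfl).1
      rw [hQe s hs, hTe]
      refine ⟨h1, ?_⟩
      have : volume.real (K + closedBall 0 s) ≤ ω * (s + D) ^ n := by
        rw [hω, ← real_closedBall_vol (by positivity)]
        refine measureReal_mono ?_ measure_closedBall_lt_top.ne
        refine (add_subset_add_right hD).trans ?_
        rw [closedBall_add_closedBall hD0.le hs, add_zero, add_comm]
      rw [add_comm R s]
      linarith
    have hT0 : T ≠ 0 := by
      intro h; have := hQT 0 le_rfl; rw [h, Polynomial.eval_zero] at this; linarith [this.1, this.2]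
    by_contra hdeg
    push Not at hdeg
    have hlim := Polynomial.abs_div_tendsto_atTop_atTop_of_degree_gt Q T (hTd.trans_le hdeg) hT0
    obtain ⟨s, hs1, hs0⟩ := ((hlim.eventually_gt_atTop 1).and (eventually_ge_atTop 0)).exists
    obtain ⟨q1, q2⟩ := hQT s hs0
    have hTp : 0 < T.eval s := by linarith
    rw [abs_of_nonneg (by positivity), lt_div_iff₀ hTp] at hs1
    linarith
  rw [← hQe s (by linarith), Lagrange.eq_interpolate (f := Q) hv (by simpa using hQdeg), Lagrange.interpolate_apply, Polynomial.eval_finsetSum,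
    Finset.sum_mul, Finset.sum_mul]
  refine Finset.sum_le_sum fun i hi => ?_
  rw [Polynomial.eval_mul, Polynomial.eval_C]
  have hi' : (i : ℝ) ≤ n := by exact_mod_cast (Finset.mem_range.1 hi).le
  have hv0 : 0 ≤ v i := by simp only [v]; positivity
  have hvr : v i ≤ r := by
    simp only [v]
    calc r * (i / n) ≤ r * 1 := by gcongr; rwa [div_le_one hnR]
      _ = r := mul_one r
  have h1 := deficit_range hn hK hb hR hvol hv0 hvr
  rw [← hω, ← hQe (v i) hv0] at h1
  calc _ ≤ Q.eval (v i) * |(Lagrange.basis (Finset.range n) v i).eval s| := by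
        gcongr; exacts [h1.1, le_abs_self _]
    _ ≤ δ * (c i * s ^ (n - 1)) := by
        gcongr
        · exact h1.1.trans h1.2
        · exact h1.2
        · exact hc i hi s hs
    _ = _ := by ring

theorem deficit_small {n : ℕ} (hn : 0 < n) {R r : ℝ} (hR : 0 < R) (hr : 0 < r) :
    ∃ C : ℝ, 0 ≤ C ∧ ∀ K : Set (EuclideanSpace ℝ (Fin n)), Convex ℝ K → IsBounded K →
    volume.real K = volume.real (closedBall (0 : EuclideanSpace ℝ (Fin n)) 1) * R ^ n →
    ∀ t, 0 < t → t ≤ 1 →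
    volume.real (closedBall 0 1 + t • K) ≤ volume.real (closedBall (0 : EuclideanSpace ℝ (Fin n)) 1) * (1 + t * R) ^ n +
    C * (volume.real (K + closedBall 0 r)
        - volume.real (closedBall (0 : EuclideanSpace ℝ (Fin n)) 1) * (R + r) ^ n) * t := by
  obtain ⟨C, hC0, hC⟩ := deficit_growth hn hR hr
  refine ⟨C, hC0, fun K hK hb hvol t ht ht1 => ?_⟩
  have h := hC K hK hb hvol t⁻¹ ((one_le_inv₀ ht).2 ht1)
  have e : closedBall (0 : EuclideanSpace ℝ (Fin n)) 1 + t • K = t • (K + closedBall 0 t⁻¹) := by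
    rw [smul_add, ← closedBall_smul_one (by positivity : 0 ≤ t⁻¹), smul_smul, mul_inv_cancel₀ ht.ne', one_smul, add_comm]
  rw [e, real_smul_vol _ ht.le]
  have h2 := mul_le_mul_of_nonneg_left h (pow_nonneg ht.le n)
  have e1 : t ^ n * (R + t⁻¹) ^ n = (1 + t * R) ^ n := by
    rw [← mul_pow]; congr 1; field_simp; ring
  have e2 : t ^ n * t⁻¹ ^ (n - 1) = t := by
    obtain ⟨k, rfl⟩ : ∃ k, n = k + 1 := ⟨n - 1, by omega⟩
    rw [Nat.add_sub_cancel, pow_succ, inv_pow]; field_simp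
  rw [← e1]
  nlinarith [mul_comm (t^n) (t⁻¹ ^ (n-1)), congrArg (fun z => z * (C * (volume.real (K + closedBall 0 r)
        - volume.real (closedBall (0 : EuclideanSpace ℝ (Fin n)) 1) * (R + r) ^ n))) e2]


theorem cont_intOn {n : ℕ} {A : Set (EuclideanSpace ℝ (Fin n))} (hA : IsCompact A)
    {f : EuclideanSpace ℝ (Fin n) → ℝ} (hf : Continuous f) : IntegrableOn f A volume :=
  hf.continuousOn.integrableOn_compact hA

theorem half_lintegral {n : ℕ} (l : EuclideanSpace ℝ (Fin n) →L[ℝ] ℝ) {A : Set (EuclideanSpace ℝ (Fin n))}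
    (hA : IsCompact A) : ∫⁻ x in A, ENNReal.ofReal (l x) ^ 2 = ENNReal.ofReal (∫ x in A, (max (l x) 0) ^ 2) := by
  rw [ofReal_integral_eq_lintegral_ofReal]
  · congr 1; ext x
    rw [ENNReal.ofReal_pow (le_max_right _ _), ENNReal.ofReal_max]
    simp
  · exact cont_intOn hA (by fun_prop)
  · exact Eventually.of_forall fun x => by positivity

theorem bm_half_real {n : ℕ} (l : EuclideanSpace ℝ (Fin n) →L[ℝ] ℝ)
    {A B : Set (EuclideanSpace ℝ (Fin n))} (hA : Convex ℝ A) (hB : Convex ℝ B)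
    (cA : IsCompact A) (cB : IsCompact B)
    {α β : ℝ} (hα : 0 < α) (hβ : 0 < β)
    (h1 : α ^ (n + 2) ≤ ∫ x in A, (max (l x) 0) ^ 2)
    (h2 : β ^ (n + 2) ≤ ∫ x in B, (max (l x) 0) ^ 2) :
    (α + β) ^ (n + 2) ≤ ∫ x in A + B, (max (l x) 0) ^ 2 := by
  have := bm_half l hA hB hα hβ (by rw [half_lintegral l cA]; exact ENNReal.ofReal_le_ofReal h1)
    (by rw [half_lintegral l cB]; exact ENNReal.ofReal_le_ofReal h2)
  rw [half_lintegral l (cA.add cB)] at this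
  exact (ENNReal.ofReal_le_ofReal_iff (integral_nonneg fun x => by positivity)).1 this

theorem half_sum {n : ℕ} (l : EuclideanSpace ℝ (Fin n) →L[ℝ] ℝ)
    {A : Set (EuclideanSpace ℝ (Fin n))} (cA : IsCompact A) :
    (∫ x in A, (max (l x) 0) ^ 2) + (∫ x in A, (max ((-l) x) 0) ^ 2) = ∫ x in A, (l x) ^ 2 := by
  rw [← integral_add (cont_intOn cA (by fun_prop)) (cont_intOn cA (by fun_prop))]
  congr 1; ext x
  rcases le_total 0 (l x) with h | h
  · simp [h]
  · simp [h]

theorem half_diff {n : ℕ} (l : EuclideanSpace ℝ (Fin n) →L[ℝ] ℝ)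
    {A : Set (EuclideanSpace ℝ (Fin n))} (cA : IsCompact A) :
    (∫ x in A, (max (l x) 0) ^ 2) - (∫ x in A, (max ((-l) x) 0) ^ 2) = ∫ x in A, (l x) * |l x| := by
  rw [← integral_sub (cont_intOn cA (by fun_prop)) (cont_intOn cA (by fun_prop))]
  congr 1; ext x
  rcases le_total 0 (l x) with h | h
  · simp [h, abs_of_nonneg h]; ring
  · simp [h, abs_of_nonpos h]; ring

theorem bm_full {n : ℕ} (l : EuclideanSpace ℝ (Fin n) →L[ℝ] ℝ)
    {A B : Set (EuclideanSpace ℝ (Fin n))} (hA : Convex ℝ A) (hB : Convex ℝ B)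
    (cA : IsCompact A) (cB : IsCompact B)
    (bA : ∫ x in A, (l x) * |l x| = 0) (bB : ∫ x in B, (l x) * |l x| = 0)
    {α β : ℝ} (hα : 0 < α) (hβ : 0 < β)
    (h1 : α ^ (n + 2) ≤ ∫ x in A, (l x) ^ 2)
    (h2 : β ^ (n + 2) ≤ ∫ x in B, (l x) ^ 2) :
    (α + β) ^ (n + 2) ≤ ∫ x in A + B, (l x) ^ 2 := by
  have sA := half_sum l cA
  have sB := half_sum l cB
  have dA := half_diff l cA
  have dB := half_diff l cB
  have sC := half_sum l (cA.add cB)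
  rw [bA] at dA
  rw [bB] at dB
  set θ : ℝ := (1 / 2 : ℝ) ^ ((n + 2 : ℕ) : ℝ)⁻¹ with hθ
  have hθ0 : 0 < θ := by positivity
  have hθn : θ ^ (n + 2) = 1 / 2 := Real.rpow_inv_natCast_pow (by norm_num) (by omega)
  have a1 := bm_half_real l hA hB cA cB (mul_pos hθ0 hα) (mul_pos hθ0 hβ)
    (by rw [mul_pow, hθn]; linarith) (by rw [mul_pow, hθn]; linarith)
  have a2 := bm_half_real (-l) hA hB cA cB (mul_pos hθ0 hα) (mul_pos hθ0 hβ)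
    (by rw [mul_pow, hθn]; linarith) (by rw [mul_pow, hθn]; linarith)
  rw [← mul_add, mul_pow, hθn] at a1 a2
  linarith

theorem moment_near {n : ℕ} {A : Set (EuclideanSpace ℝ (Fin n))} (cA : IsCompact A) {η : ℝ}
    (h0 : 0 ≤ η) (h1 : η ≤ 1) (hin : closedBall 0 (1 - η) ⊆ A) (hout : A ⊆ closedBall 0 (1 + η)) :
    |(∫ x in A, (‖x‖ ^ 2 - 1)) - ∫ x in closedBall (0 : EuclideanSpace ℝ (Fin n)) (1 - η), (‖x‖ ^ 2 - 1)| ≤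
      3 * η * (volume.real (closedBall (0 : EuclideanSpace ℝ (Fin n)) 1) * ((1 + η) ^ n - (1 - η) ^ n)) := by
  have hc : Continuous (fun x : EuclideanSpace ℝ (Fin n) => ‖x‖ ^ 2 - 1) := by fun_prop
  rw [← setIntegral_sdiff measurableSet_closedBall (cont_intOn cA hc) hin]
  have hvol : volume.real (closedBall (0 : EuclideanSpace ℝ (Fin n)) (1 + η) \ closedBall 0 (1 - η)) =
      volume.real (closedBall (0 : EuclideanSpace ℝ (Fin n)) 1) * ((1 + η) ^ n - (1 - η) ^ n) := by
    rw [measureReal_sdiff (closedBall_subset_closedBall (by linarith)) measurableSet_closedBall (h₁ := measure_closedBall_lt_top.ne),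
      real_closedBall_vol (s := 1 + η) (by linarith), real_closedBall_vol (s := 1 - η) (by linarith)]
    ring
  have hfin : volume (A \ closedBall 0 (1 - η)) < ⊤ := (measure_mono sdiff_subset).trans_lt cA.measure_lt_top
  have := norm_setIntegral_le_of_norm_le_const (μ := volume) (f := fun x : EuclideanSpace ℝ (Fin n) => ‖x‖ ^ 2 - 1)
    (s := A \ closedBall 0 (1 - η)) (C := 3 * η) hfin (by
      rintro x ⟨hx1, hx2⟩
      have u1 := hout hx1
      rw [mem_closedBall_zero_iff] at u1 hx2
      push Not at hx2
      rw [Real.norm_eq_abs, abs_le]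
      constructor <;> nlinarith [norm_nonneg x])
  refine (this.trans ?_)
  rw [← hvol]
  gcongr
  · exact (measure_closedBall_lt_top).ne ∘ fun h => measure_mono_top sdiff_subset h
  

theorem moment_upper {n : ℕ} {W : Set (EuclideanSpace ℝ (Fin n))} (cW : IsCompact W) {η : ℝ}
    (h0 : 0 ≤ η) (h1 : η ≤ 1) (hin : closedBall 0 (1 - η) ⊆ W) (hout : W ⊆ closedBall 0 (1 + η)) :
    (∫ x in W, ‖x‖ ^ 2) ≤ (∫ x in closedBall (0 : EuclideanSpace ℝ (Fin n)) 1, ‖x‖ ^ 2) +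
      (volume.real W - volume.real (closedBall (0 : EuclideanSpace ℝ (Fin n)) 1)) +
      6 * η * (volume.real (closedBall (0 : EuclideanSpace ℝ (Fin n)) 1) * ((1 + η) ^ n - (1 - η) ^ n)) := by
  have a1 := moment_near cW h0 h1 hin hout
  have a2 := moment_near (n := n) (isCompact_closedBall 0 1) h0 h1
    (closedBall_subset_closedBall (by linarith)) (closedBall_subset_closedBall (by linarith))
  have e : ∀ A : Set (EuclideanSpace ℝ (Fin n)), IsCompact A → (∫ x in A, (‖x‖ ^ 2 - 1)) = (∫ x in A, ‖x‖ ^ 2) - volume.real A := by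
    intro A hA
    rw [integral_sub (cont_intOn hA (by fun_prop)) (cont_intOn hA (by fun_prop))]
    simp
  rw [e W cW] at a1
  rw [e _ (isCompact_closedBall 0 1)] at a2
  have b1 := (abs_le.1 a1).2
  have b2 := (abs_le.1 a2).1
  linarith

theorem smul_setIntegral_hom {n : ℕ} (A : Set (EuclideanSpace ℝ (Fin n))) {t : ℝ} (ht : 0 < t)
    (f : EuclideanSpace ℝ (Fin n) → ℝ) (hf : ∀ x, f (t • x) = t ^ 2 * f x) :
    ∫ x in t • A, f x = t ^ (n + 2) * ∫ x in A, f x := by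
  have := Measure.setIntegral_comp_smul_of_pos volume f A ht
  simp only [hf, integral_const_mul, finrank_euclideanSpace, Fintype.card_fin, smul_eq_mul] at this
  rw [pow_add, mul_assoc, this]
  field_simp

theorem ball_inv {n : ℕ} (T : EuclideanSpace ℝ (Fin n) ≃ₗᵢ[ℝ] EuclideanSpace ℝ (Fin n))
    (f : EuclideanSpace ℝ (Fin n) → ℝ) (s : ℝ) :
    ∫ x in closedBall (0 : EuclideanSpace ℝ (Fin n)) s, f (T x) = ∫ x in closedBall (0 : EuclideanSpace ℝ (Fin n)) s, f x := by
  have hpre : T ⁻¹' (closedBall 0 s) = closedBall 0 s := by ext y; simp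
  have := T.measurePreserving.setIntegral_preimage_emb T.toHomeomorph.measurableEmbedding f (closedBall 0 s)
  rw [← this, hpre]

theorem ball_balanced {n : ℕ} (l : EuclideanSpace ℝ (Fin n) →L[ℝ] ℝ) (s : ℝ) :
    ∫ x in closedBall (0 : EuclideanSpace ℝ (Fin n)) s, l x * |l x| = 0 := by
  have := ball_inv (LinearIsometryEquiv.neg ℝ) (fun x => l x * |l x|) s
  simp [integral_neg] at this
  linarith

theorem ball_coord {n : ℕ} (i k : Fin n) (s : ℝ) :
    ∫ x in closedBall (0 : EuclideanSpace ℝ (Fin n)) s, (x i) ^ 2 = ∫ x in closedBall (0 : EuclideanSpace ℝ (Fin n)) s, (x k) ^ 2 := by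
  have := ball_inv (LinearIsometryEquiv.piLpCongrLeft 2 ℝ ℝ (Equiv.swap i k)) (fun x => (x i) ^ 2) s
  rw [← this]
  congr 1; ext x
  simp [LinearIsometryEquiv.piLpCongrLeft_apply, Equiv.piCongrLeft'_apply]

theorem sum_coord {n : ℕ} {A : Set (EuclideanSpace ℝ (Fin n))} (cA : IsCompact A) :
    ∫ x in A, ‖x‖ ^ 2 = ∑ i, ∫ x in A, (x i) ^ 2 := by
  rw [← integral_finsetSum]
  · congr 1; ext x; rw [EuclideanSpace.real_norm_sq_eq]
  · intro i _; exact cont_intOn cA (by fun_prop)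


theorem pow_le_lin (k : ℕ) {t : ℝ} (ht : 0 ≤ t) : (1 + t) ^ k ≤ 1 + k * t * (1 + t) ^ k := by
  induction k with
  | zero => simp
  | succ k ih =>
    have h1 : 1 ≤ (1 + t) ^ (k + 1) := one_le_pow₀ (by linarith)
    have h2 : (1 + t) * (1 + t) ^ k ≤ (1 + t) * (1 + k * t * (1 + t) ^ k) := by gcongr
    push_cast
    have e : (1 + t) ^ (k + 1) = (1 + t) * (1 + t) ^ k := by ring
    have h3 := mul_le_mul_of_nonneg_left h1 ht
    have e2 : (1 + t) * (1 + k * t * (1 + t) ^ k) = 1 + t * 1 + k * t * (1 + t) ^ (k + 1) := by ring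
    have e3 : 1 + ((k : ℝ) + 1) * t * (1 + t) ^ (k + 1) = 1 + t * (1 + t) ^ (k + 1) + k * t * (1 + t) ^ (k + 1) := by ring
    rw [e3]
    linarith

theorem ball_coord_val {n : ℕ} (hn : 0 < n) (i : Fin n) :
    ∫ x in closedBall (0 : EuclideanSpace ℝ (Fin n)) 1, (x i) ^ 2 =
      (∫ x in closedBall (0 : EuclideanSpace ℝ (Fin n)) 1, ‖x‖ ^ 2) / n := by
  rw [sum_coord (isCompact_closedBall 0 1), Finset.sum_congr rfl (fun k _ => ball_coord k i 1)]
  have : (n : ℝ) ≠ 0 := by positivity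
  simp
  field_simp

theorem omega_le {n : ℕ} : volume.real (closedBall (0 : EuclideanSpace ℝ (Fin n)) 1) * n ≤
    (n + 2 : ℝ) * ∫ x in closedBall (0 : EuclideanSpace ℝ (Fin n)) 1, ‖x‖ ^ 2 := by
  set ω := volume.real (closedBall (0 : EuclideanSpace ℝ (Fin n)) 1) with hω
  set M := ∫ x in closedBall (0 : EuclideanSpace ℝ (Fin n)) 1, ‖x‖ ^ 2 with hM
  have hω0 : 0 < ω := omega_pos n
  have hM0 : 0 ≤ M := integral_nonneg fun x => by positivity
  have key : ∀ t : ℝ, 0 < t → ω * n ≤ (n + 2 : ℝ) * M * (1 + t) ^ (n + 2) := by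
    intro t ht
    have c1 : Continuous (fun x : EuclideanSpace ℝ (Fin n) => ‖x‖ ^ 2 - 1) := by fun_prop
    have e : ∀ s, (∫ x in closedBall (0 : EuclideanSpace ℝ (Fin n)) s, (‖x‖ ^ 2 - 1)) =
        (∫ x in closedBall (0 : EuclideanSpace ℝ (Fin n)) s, ‖x‖ ^ 2) - volume.real (closedBall (0 : EuclideanSpace ℝ (Fin n)) s) := by
      intro s
      rw [integral_sub (cont_intOn (isCompact_closedBall 0 s) (by fun_prop)) (cont_intOn (isCompact_closedBall 0 s) (by fun_prop))]
      simp
    have h1 := setIntegral_sdiff (μ := volume) (s := closedBall (0 : EuclideanSpace ℝ (Fin n)) (1 + t))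
      (t := closedBall 0 1) measurableSet_closedBall (cont_intOn (isCompact_closedBall 0 _) c1)
      (closedBall_subset_closedBall (by linarith))
    have h2 : 0 ≤ ∫ x in closedBall (0 : EuclideanSpace ℝ (Fin n)) (1 + t) \ closedBall 0 1, (‖x‖ ^ 2 - 1) := by
      refine setIntegral_nonneg (measurableSet_closedBall.diff measurableSet_closedBall) ?_
      rintro x ⟨_, hx⟩
      rw [mem_closedBall_zero_iff] at hx
      push Not at hx
      nlinarith
    rw [h1, e, e, ← hM, ← hω] at h2
    have h3 := smul_setIntegral_hom (closedBall (0 : EuclideanSpace ℝ (Fin n)) 1) (t := 1 + t) (by linarith)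
      (fun x => ‖x‖ ^ 2) (by intro x; rw [norm_smul, mul_pow, Real.norm_eq_abs, sq_abs])
    rw [closedBall_smul_one (by linarith), ← hM] at h3
    rw [h3, real_closedBall_vol (by linarith), ← hω] at h2
    have b1 := one_add_mul_le_pow (show (-2 : ℝ) ≤ t by linarith) n
    have b2 := pow_le_lin (n + 2) ht.le
    push_cast at b2
    have d1 : ω * (1 + n * t) ≤ ω * (1 + t) ^ n := by gcongr
    have d2 : M * (1 + t) ^ (n + 2) ≤ M * (1 + (n + 2) * t * (1 + t) ^ (n + 2)) := by gcongr
    have : t * (ω * n) ≤ t * ((n + 2 : ℝ) * M * (1 + t) ^ (n + 2)) := by nlinarith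
    exact le_of_mul_le_mul_left this ht
  have hlim : Tendsto (fun t : ℝ => (n + 2 : ℝ) * M * (1 + t) ^ (n + 2)) (nhdsWithin 0 (Ioi 0)) (nhds ((n + 2 : ℝ) * M)) := by
    have : Continuous (fun t : ℝ => (n + 2 : ℝ) * M * (1 + t) ^ (n + 2)) := by fun_prop
    have := (this.tendsto 0).mono_left (nhdsWithin_le_nhds (s := Ioi 0))
    simpa using this
  exact ge_of_tendsto hlim (by filter_upwards [self_mem_nhdsWithin] with t ht using key t ht)

theorem coord_bm {n : ℕ} (hn : 0 < n) (i : Fin n) {K : Set (EuclideanSpace ℝ (Fin n))} (hK : Convex ℝ K)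
    (cK : IsCompact K) {j : ℝ} (hj0 : 0 < j)
    (hj : j = (∫ x in closedBall (0 : EuclideanSpace ℝ (Fin n)) 1, ‖x‖ ^ 2) / n)
    {t z : ℝ} (ht : 0 < t) (hz : 0 < z) (hbal : ∫ x in K, (x i) * |x i| = 0)
    (hJ : ∫ x in K, (x i) ^ 2 = z ^ (n + 2) * j) :
    j * (1 + (n + 2) * (t * z)) ≤ ∫ x in closedBall (0 : EuclideanSpace ℝ (Fin n)) 1 + t • K, (x i) ^ 2 := by
  set θ : ℝ := j ^ ((n + 2 : ℕ) : ℝ)⁻¹ with hθ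
  have hθ0 : 0 < θ := by positivity
  have hθn : θ ^ (n + 2) = j := Real.rpow_inv_natCast_pow hj0.le (by omega)
  clear_value θ
  have b1 : ∫ x in closedBall (0 : EuclideanSpace ℝ (Fin n)) 1, (x i) ^ 2 = j := by rw [hj]; exact ball_coord_val hn i
  have b2 := smul_setIntegral_hom K ht (fun x => (x i) ^ 2) (by intro x; simp [mul_pow])
  have b3 := smul_setIntegral_hom K ht (fun x => (x i) * |x i|) (by
    intro x
    simp only [PiLp.smul_apply, smul_eq_mul, abs_mul, abs_of_pos ht]
    ring)
  rw [hbal, mul_zero] at b3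
  have h1 : θ ^ (n + 2) ≤ ∫ x in closedBall (0 : EuclideanSpace ℝ (Fin n)) 1, (x i) ^ 2 := by rw [b1, hθn]
  have h2 : (θ * (t * z)) ^ (n + 2) ≤ ∫ x in t • K, (x i) ^ 2 := by
    rw [b2, hJ, mul_pow, hθn, mul_pow]; apply le_of_eq; ring
  have p2 : 0 < θ * (t * z) := by positivity
  have b4 : (θ + θ * (t * z)) ^ (n + 2) ≤ ∫ x in closedBall (0 : EuclideanSpace ℝ (Fin n)) 1 + t • K, (x i) ^ 2 :=
    bm_full (EuclideanSpace.proj i : EuclideanSpace ℝ (Fin n) →L[ℝ] ℝ) (convex_closedBall (0 : EuclideanSpace ℝ (Fin n)) 1) (hK.smul t)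
      (isCompact_closedBall 0 1) (cK.smul t) (ball_balanced _ 1) b3 hθ0 p2 h1 h2
  have b5 : θ + θ * (t * z) = θ * (1 + t * z) := by ring
  rw [b5, mul_pow, hθn] at b4
  refine le_trans ?_ b4
  have b0 : 0 < t * z := by positivity
  have b6 := one_add_mul_le_pow (show (-2 : ℝ) ≤ t * z by linarith) (n + 2)
  push_cast at b6
  gcongr

theorem sum_y_le {n : ℕ} (hn : 0 < n) {R r : ℝ} (hR : 0 < R) (hr : 0 < r) :
    ∃ C : ℝ, 0 ≤ C ∧ ∀ K : Set (EuclideanSpace ℝ (Fin n)), Convex ℝ K → IsCompact K →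
    volume.real K = volume.real (closedBall (0 : EuclideanSpace ℝ (Fin n)) 1) * R ^ n →
    (∀ i : Fin n, ∫ x in K, (x i) * |x i| = 0) → ∀ y : Fin n → ℝ, (∀ i, 0 < y i) →
    (∀ i : Fin n, ∫ x in K, (x i) ^ 2 = (y i * R) ^ (n + 2) *
      ((∫ x in closedBall (0 : EuclideanSpace ℝ (Fin n)) 1, ‖x‖ ^ 2) / n)) →
    ∑ i, y i ≤ n + C * (volume.real (K + closedBall 0 r)
        - volume.real (closedBall (0 : EuclideanSpace ℝ (Fin n)) 1) * (R + r) ^ n) := by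
  obtain ⟨C, hC0, hC⟩ := deficit_small hn hR hr
  set ω := volume.real (closedBall (0 : EuclideanSpace ℝ (Fin n)) 1) with hω
  set M := ∫ x in closedBall (0 : EuclideanSpace ℝ (Fin n)) 1, ‖x‖ ^ 2 with hM
  have hω0 : 0 < ω := omega_pos n
  have hnR : (0:ℝ) < n := by exact_mod_cast hn
  have hωM : ω * n ≤ (n + 2 : ℝ) * M := omega_le
  have hM0 : 0 < M := by
    by_contra h
    push Not at h
    nlinarith [mul_pos hω0 hnR]
  refine ⟨C / (ω * R), by positivity, ?_⟩
  intro K hK cK hvol hbal y hy hJ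
  set δ := volume.real (K + closedBall 0 r) - ω * (R + r) ^ n with hδ
  set j := M / n with hj
  have hj0 : 0 < j := by positivity
  have hjω : ω ≤ (n + 2) * j := by rw [hj]; rw [← mul_div_assoc, le_div_iff₀ hnR]; exact hωM
  have hne : K.Nonempty := by
    rw [nonempty_iff_ne_empty]; rintro rfl
    have : 0 < ω * R ^ n := by positivity
    simp at hvol; rcases hvol with h | h <;> [exact hω0.ne' h; exact hR.ne' h.1]
  obtain ⟨k0, hk0⟩ := hne
  obtain ⟨D, hD0, hD⟩ := cK.isBounded.subset_closedBall_lt 0 0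
  have hc := Finset.sum_nonneg (s := Finset.univ) (f := y) (fun i _ => (hy i).le)
  have key : ∀ t : ℝ, 0 < t → t ≤ 1 → t * D ≤ 1 → (n + 2) * j * R * ∑ i, y i ≤
      ω * n * R * (1 + t * R) ^ n + C * δ + 6 * D * (ω * ((1 + t * D) ^ n - (1 - t * D) ^ n)) := by
    intro t ht ht1 htD
    set W := closedBall (0 : EuclideanSpace ℝ (Fin n)) 1 + t • K with hW
    have cW : IsCompact W := (isCompact_closedBall 0 1).add (cK.smul t)
    have a1 := hC K hK cK.isBounded hvol t ht ht1
    rw [← hW] at a1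
    have hin : closedBall (0 : EuclideanSpace ℝ (Fin n)) (1 - t * D) ⊆ W := by
      intro x hx
      refine ⟨x - t • k0, ?_, t • k0, smul_mem_smul_set hk0, by simp⟩
      rw [mem_closedBall_zero_iff] at hx ⊢
      have h1 := hD hk0
      rw [mem_closedBall_zero_iff] at h1
      have h2 := norm_sub_le x (t • k0)
      rw [norm_smul, Real.norm_of_nonneg ht.le] at h2
      nlinarith
    have hout : W ⊆ closedBall (0 : EuclideanSpace ℝ (Fin n)) (1 + t * D) := by
      rintro _ ⟨u, hu, _, ⟨k, hk, rfl⟩, rfl⟩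
      have h1 := hD hk
      rw [mem_closedBall_zero_iff] at hu h1 ⊢
      have h2 := norm_add_le u (t • k)
      rw [norm_smul, Real.norm_of_nonneg ht.le] at h2
      have : ‖u + t • k‖ ≤ 1 + t * D := by nlinarith
      exact this
    have a2 := moment_upper cW (by positivity) htD hin hout
    rw [← hM, ← hω, sum_coord cW] at a2
    have a3 : ∀ i : Fin n, j * (1 + (n + 2) * (t * (y i * R))) ≤ ∫ x in W, (x i) ^ 2 := fun i =>
      coord_bm hn i hK cK hj0 rfl ht (mul_pos (hy i) hR) (hbal i) (hJ i)
    have a4 := Finset.sum_le_sum (s := Finset.univ) (fun i _ => a3 i)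
    have a5 : ∑ i : Fin n, j * (1 + (n + 2) * (t * (y i * R))) = M + t * ((n + 2) * j * R * ∑ i, y i) := by
      have : ∀ i : Fin n, j * (1 + (n + 2) * (t * (y i * R))) = j + (t * ((n + 2) * j * R)) * y i := by intro i; ring
      simp_rw [this]
      rw [Finset.sum_add_distrib, ← Finset.mul_sum]
      simp [hj]
      field_simp
    rw [a5] at a4
    have a6 := pow_le_lin n (show 0 ≤ t * R by positivity)
    have a7 : ω * (1 + t * R) ^ n ≤ ω * (1 + n * (t * R) * (1 + t * R) ^ n) := by gcongr
    refine le_of_mul_le_mul_left ?_ ht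
    nlinarith
  have hlim : Tendsto (fun t : ℝ => ω * n * R * (1 + t * R) ^ n + C * δ + 6 * D * (ω * ((1 + t * D) ^ n - (1 - t * D) ^ n)))
      (nhdsWithin 0 (Ioi 0)) (nhds (ω * n * R + C * δ)) := by
    have : Continuous (fun t : ℝ => ω * n * R * (1 + t * R) ^ n + C * δ + 6 * D * (ω * ((1 + t * D) ^ n - (1 - t * D) ^ n))) := by fun_prop
    have := (this.tendsto 0).mono_left (nhdsWithin_le_nhds (s := Ioi 0))
    simpa using this
  have hfin : (n + 2) * j * R * ∑ i, y i ≤ ω * n * R + C * δ := by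
    refine ge_of_tendsto hlim ?_
    have hmin : 0 < min 1 (1 / D) := by positivity
    filter_upwards [Ioo_mem_nhdsGT hmin] with t ht
    refine key t ht.1 (ht.2.le.trans (min_le_left _ _)) ?_
    have := ht.2.le.trans (min_le_right _ _)
    rwa [le_div_iff₀ hD0] at this
  have h1 : ω * R * ∑ i, y i ≤ ω * n * R + C * δ := by
    refine le_trans ?_ hfin
    gcongr
  have h2 : 0 < ω * R := by positivity
  refine le_of_mul_le_mul_left ?_ h2
  calc ω * R * ∑ i, y i ≤ ω * n * R + C * δ := h1
    _ = ω * R * (n + C / (ω * R) * δ) := by field_simp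


theorem balance {n : ℕ} {K : Set (EuclideanSpace ℝ (Fin n))} (cK : IsCompact K) :
    ∃ v : EuclideanSpace ℝ (Fin n), ∀ i : Fin n, ∫ x in K, (x i - v i) * |x i - v i| = 0 := by
  have h : ∀ i : Fin n, ∃ τ : ℝ, ∫ x in K, (x i - τ) * |x i - τ| = 0 := by
    intro i
    have hcont : Continuous (fun τ : ℝ => ∫ x in K, (x i - τ) * |x i - τ|) := by
      refine continuous_parametric_integral_of_continuous (f := fun (τ : ℝ) (x : EuclideanSpace ℝ (Fin n)) => (x i - τ) * |x i - τ|) ?_ cK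
      simp only [Function.uncurry_def]
      fun_prop
    obtain ⟨D, hD0, hD⟩ := cK.isBounded.subset_closedBall_lt 0 0
    have hx : ∀ x ∈ K, |x i| ≤ D := by
      intro x hx
      have h1 := hD hx
      rw [mem_closedBall_zero_iff] at h1
      have := PiLp.norm_apply_le x i
      rw [Real.norm_eq_abs] at this
      linarith
    have := mem_range_of_exists_le_of_exists_ge hcont (c := 0) ⟨D, ?_⟩ ⟨-D, ?_⟩
    · exact this
    · refine setIntegral_nonpos cK.measurableSet (fun x h => ?_)
      have := (abs_le.1 (hx x h)).2
      exact mul_nonpos_of_nonpos_of_nonneg (by linarith) (abs_nonneg _)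
    · refine setIntegral_nonneg cK.measurableSet (fun x h => ?_)
      have := (abs_le.1 (hx x h)).1
      exact mul_nonneg (by linarith) (abs_nonneg _)
  choose τ hτ using h
  exact ⟨WithLp.toLp 2 τ, fun i => hτ i⟩

theorem translate_add_vol {n : ℕ} (K : Set (EuclideanSpace ℝ (Fin n))) (v : EuclideanSpace ℝ (Fin n)) (B : Set (EuclideanSpace ℝ (Fin n))) :
    volume.real (((fun x => v + x) ⁻¹' K) + B) = volume.real (K + B) := by
  have : ((fun x => v + x) ⁻¹' K) + B = (fun x => v + x) ⁻¹' (K + B) := by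
    ext x
    constructor
    · rintro ⟨a, ha, b, hb, rfl⟩
      exact ⟨v + a, ha, b, hb, by simp [add_assoc]⟩
    · rintro ⟨a, ha, b, hb, h⟩
      refine ⟨-v + a, by simpa using ha, b, hb, ?_⟩
      have h' : a + b = v + x := h
      show -v + a + b = x
      rw [add_assoc, h']; simp
  rw [this, measureReal_def, measure_preimage_add, ← measureReal_def]

theorem translate_balanced {n : ℕ} {K : Set (EuclideanSpace ℝ (Fin n))} (cK : IsCompact K) :
    ∃ v : EuclideanSpace ℝ (Fin n), ∀ i : Fin n, ∫ x in (fun x => v + x) ⁻¹' K, (x i) * |x i| = 0 := by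
  obtain ⟨v, hv⟩ := balance cK
  refine ⟨v, fun i => ?_⟩
  have := (measurePreserving_add_left volume v).setIntegral_preimage_emb
    (Homeomorph.addLeft v).measurableEmbedding (fun x : EuclideanSpace ℝ (Fin n) => (x i - v i) * |x i - v i|) K
  rw [hv i] at this
  simpa using this

theorem pow_second (L : ℝ) (hL : 0 ≤ L) (k : ℕ) : ∃ C : ℝ, 0 ≤ C ∧ ∀ y : ℝ, 0 ≤ y → y ≤ L →
    y ^ k - 1 - k * (y - 1) ≤ C * (y - 1) ^ 2 := by
  induction k with
  | zero => exact ⟨0, le_rfl, fun y _ _ => by simp⟩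
  | succ k ih =>
    obtain ⟨C, hC, h⟩ := ih
    refine ⟨L * C + k, by positivity, fun y h0 h1 => ?_⟩
    have a := mul_le_mul_of_nonneg_left (h y h0 h1) h0
    have b : y * (C * (y - 1) ^ 2) ≤ L * (C * (y - 1) ^ 2) := by gcongr
    push_cast
    have e : y ^ (k + 1) - 1 - (k + 1) * (y - 1) = y * (y ^ k - 1 - k * (y - 1)) + k * (y - 1) ^ 2 := by ring
    rw [e]
    linarith

theorem sq_le_log {L y : ℝ} (hy : 0 < y) (hL : y ≤ L) : (y - 1) ^ 2 ≤ (L + 2) ^ 2 * (y - 1 - Real.log y) := by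
  set s := Real.sqrt y with hs
  have hs0 : 0 < s := Real.sqrt_pos.2 hy
  have hsy : s ^ 2 = y := Real.sq_sqrt hy.le
  have h1 : Real.log y ≤ 2 * (s - 1) := by
    rw [← hsy, Real.log_pow]
    have := Real.log_le_sub_one_of_pos hs0
    push_cast
    linarith
  have h2 : (s - 1) ^ 2 ≤ y - 1 - Real.log y := by nlinarith
  have h3 : s + 1 ≤ L + 2 := by nlinarith [sq_nonneg (s - 1)]
  have e : (y - 1) ^ 2 = (s + 1) ^ 2 * (s - 1) ^ 2 := by rw [← hsy]; ring
  rw [e]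
  gcongr

theorem scalar_stab (n q : ℕ) : ∃ C : ℝ, 0 ≤ C ∧ ∀ (y : Fin n → ℝ) (η : ℝ), (∀ i, 0 < y i) → 1 ≤ ∏ i, y i →
    ∑ i, y i ≤ n + η → η ≤ 1 → ∑ i, (y i) ^ q ≤ n + C * η := by
  obtain ⟨C, hC0, hC⟩ := pow_second (n + 1) (by positivity) q
  refine ⟨q + C * (n + 1 + 2) ^ 2, by positivity, fun y η hy hp hs hη => ?_⟩
  have hlog : 0 ≤ ∑ i, Real.log (y i) := by
    rw [← Real.log_prod (fun i _ => (hy i).ne')]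
    exact Real.log_nonneg hp
  have hle : ∀ i, y i ≤ n + 1 := by
    intro i
    have := Finset.single_le_sum (f := y) (fun i _ => (hy i).le) (Finset.mem_univ i)
    linarith
  have h1 : ∀ i, y i ^ q ≤ 1 + q * (y i - 1) + C * ((n + 1 + 2) ^ 2 * (y i - 1 - Real.log (y i))) := by
    intro i
    have a := hC (y i) (hy i).le (hle i)
    have b := mul_le_mul_of_nonneg_left (sq_le_log (hy i) (hle i)) hC0
    linarith
  have h2 := Finset.sum_le_sum (s := Finset.univ) (fun i _ => h1 i)
  refine h2.trans ?_
  simp only [Finset.sum_add_distrib, ← Finset.mul_sum, Finset.sum_sub_distrib, Finset.sum_const, Finset.card_univ, Fintype.card_fin, nsmul_eq_mul, mul_one]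
  have h3 : C * ((n + 1 + 2) ^ 2 * (∑ i, y i - n - ∑ i, Real.log (y i))) ≤ C * ((n + 1 + 2) ^ 2 * η) := by
    gcongr
    linarith
  have h4 : (q : ℝ) * (∑ i, y i - n) ≤ q * η := by gcongr; linarith
  linarith

theorem shell_vol {n : ℕ} {R : ℝ} (hR : 0 < R) : ∃ c : ℝ, 0 < c ∧ ∀ s, 0 ≤ s → s ≤ 1 →
    volume.real (closedBall (0 : EuclideanSpace ℝ (Fin n)) (R + s) \ closedBall 0 R) ≤ c * s := by
  set ω := volume.real (closedBall (0 : EuclideanSpace ℝ (Fin n)) 1) with hω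
  have hω0 : 0 < ω := omega_pos n
  refine ⟨ω * (R ^ n * (n * R⁻¹ * (1 + R⁻¹) ^ n)) + 1, by positivity, fun s h0 h1 => ?_⟩
  rw [measureReal_sdiff (closedBall_subset_closedBall (by linarith)) measurableSet_closedBall (h₁ := measure_closedBall_lt_top.ne),
      real_closedBall_vol (s := R + s) (by linarith), real_closedBall_vol (s := R) (by linarith), ← hω]
  have a := pow_le_lin n (show 0 ≤ s * R⁻¹ by positivity)
  have b : (1 + s * R⁻¹) ^ n ≤ (1 + R⁻¹) ^ n := by
    gcongr
    have : 0 < R⁻¹ := by positivity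
    nlinarith
  have e : (R + s) ^ n = R ^ n * (1 + s * R⁻¹) ^ n := by rw [← mul_pow]; congr 1; field_simp
  have c1 : n * (s * R⁻¹) * (1 + s * R⁻¹) ^ n ≤ n * (s * R⁻¹) * (1 + R⁻¹) ^ n := by gcongr
  have d : R ^ n * (1 + s * R⁻¹) ^ n ≤ R ^ n * (1 + n * (s * R⁻¹) * (1 + R⁻¹) ^ n) := by gcongr; linarith
  have f := mul_le_mul_of_nonneg_left d hω0.le
  rw [e]
  nlinarith

theorem bathtub {n : ℕ} {R : ℝ} (hR : 0 < R) : ∃ c : ℝ, 0 < c ∧ ∀ A : Set (EuclideanSpace ℝ (Fin n)), IsCompact A →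
    volume.real A = volume.real (closedBall (0 : EuclideanSpace ℝ (Fin n)) 1) * R ^ n →
    (∫ x in closedBall (0 : EuclideanSpace ℝ (Fin n)) R, ‖x‖ ^ 2) + c * (volume.real (A \ closedBall 0 R)) ^ 2 ≤ ∫ x in A, ‖x‖ ^ 2 := by
  obtain ⟨c0, hc0, hsh⟩ := shell_vol (n := n) hR
  set ω := volume.real (closedBall (0 : EuclideanSpace ℝ (Fin n)) 1) with hω
  have hω0 : 0 < ω := omega_pos n
  set c1 := c0 + ω * R ^ n with hc1
  have hc1p : 0 < c1 := by positivity
  refine ⟨R / (2 * c1), by positivity, fun A cA hA => ?_⟩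
  set d := volume.real (A \ closedBall 0 R) with hd
  set B := closedBall (0 : EuclideanSpace ℝ (Fin n)) R with hB
  have cB : IsCompact B := isCompact_closedBall 0 R
  have hd0 : 0 ≤ d := measureReal_nonneg
  have hdA : d ≤ ω * R ^ n := by
    rw [← hA]; exact measureReal_mono sdiff_subset cA.measure_lt_top.ne
  set s := d / (2 * c1) with hs
  have hs0 : 0 ≤ s := by positivity
  have hs1 : s ≤ 1 := by rw [hs, div_le_one (by positivity)]; linarith
  have hcs : c0 * s ≤ d / 2 := by
    have : c1 * s = d / 2 := by rw [hs]; field_simp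
    have : c0 * s ≤ c1 * s := by gcongr; rw [hc1]; nlinarith [pow_pos hR n]
    linarith
  let f : EuclideanSpace ℝ (Fin n) → ℝ := fun x => ‖x‖ ^ 2 - R ^ 2
  have hf : Continuous f := by fun_prop
  have e : ∀ S : Set (EuclideanSpace ℝ (Fin n)), IsCompact S → ∫ x in S, f x = (∫ x in S, ‖x‖ ^ 2) - R ^ 2 * volume.real S := by
    intro S hS
    rw [integral_sub (cont_intOn hS (by fun_prop)) (cont_intOn hS (by fun_prop))]
    simp [mul_comm]
  have iA := cont_intOn cA hf
  have iB := cont_intOn cB hf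
  have sA := integral_inter_add_sdiff (μ := volume) (s := A) (t := B) cB.measurableSet iA
  have sB := integral_inter_add_sdiff (μ := volume) (s := B) (t := A) cA.measurableSet iB
  rw [inter_comm] at sB
  have nB : ∫ x in B \ A, f x ≤ 0 := by
    refine setIntegral_nonpos (cB.measurableSet.diff cA.measurableSet) ?_
    rintro x ⟨hx, _⟩
    rw [hB, mem_closedBall_zero_iff] at hx
    have := norm_nonneg x
    simp only [f]; nlinarith
  set T := closedBall (0 : EuclideanSpace ℝ (Fin n)) (R + s) with hT
  have mAB : MeasurableSet (A \ B) := cA.measurableSet.diff cB.measurableSet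
  have hpos : ∀ x ∈ A \ B, 0 ≤ f x := by
    rintro x ⟨_, hx⟩
    rw [hB, mem_closedBall_zero_iff] at hx
    simp only [f]; nlinarith
  have iAB : IntegrableOn f (A \ B) := iA.mono_set sdiff_subset
  have h1 : ∫ x in (A \ B) \ T, f x ≤ ∫ x in A \ B, f x := by
    refine setIntegral_mono_set iAB ?_ sdiff_subset.eventuallyLE
    filter_upwards [ae_restrict_mem mAB] with x hx using hpos x hx
  have mABT : MeasurableSet ((A \ B) \ T) := mAB.diff measurableSet_closedBall
  have fABT : volume ((A \ B) \ T) ≠ ⊤ :=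
    ((measure_mono (sdiff_subset.trans sdiff_subset)).trans_lt cA.measure_lt_top).ne
  have h2 : 2 * R * s * volume.real ((A \ B) \ T) ≤ ∫ x in (A \ B) \ T, f x := by
    have := setIntegral_mono_on (μ := volume) (s := (A \ B) \ T) (f := fun _ => 2 * R * s) (g := f)
      (by exact integrableOn_const fABT) (iAB.mono_set sdiff_subset) mABT (by
        rintro x ⟨_, hx⟩
        rw [hT, mem_closedBall_zero_iff] at hx
        simp only [f]; nlinarith)
    simpa [mul_comm] using this
  have h3 : d / 2 ≤ volume.real ((A \ B) \ T) := by
    have := measureReal_mono (μ := volume) (s₁ := A \ B) (s₂ := ((A \ B) \ T) ∪ (T \ B)) (by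
      rintro x hx
      by_cases h : x ∈ T
      · exact Or.inr ⟨h, hx.2⟩
      · exact Or.inl ⟨hx, h⟩) (by
        refine (measure_union_lt_top fABT.lt_top ?_).ne
        exact (measure_mono sdiff_subset).trans_lt measure_closedBall_lt_top)
    have u := measureReal_union_le (μ := volume) ((A \ B) \ T) (T \ B)
    have w := hsh s hs0 hs1
    linarith
  have h4 : 2 * R * s * (d / 2) ≤ 2 * R * s * volume.real ((A \ B) \ T) := by gcongr
  have e5 : R / (2 * c1) * d ^ 2 = 2 * R * s * (d / 2) := by rw [hs]; field_simp
  have hvB : volume.real B = ω * R ^ n := real_closedBall_vol hR.le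
  rw [e A cA, hA] at sA
  rw [e B cB, hvB] at sB
  rw [e5]
  linarith


theorem diag_moment {n : ℕ} {K : Set (EuclideanSpace ℝ (Fin n))} (cK : IsCompact K) (a : Fin n → ℝ) (ha : ∏ i, a i = 1) :
    ∃ A : Set (EuclideanSpace ℝ (Fin n)), IsCompact A ∧ volume.real A = volume.real K ∧
      ∫ x in A, ‖x‖ ^ 2 = ∑ i, (a i) ^ 2 * ∫ x in K, (x i) ^ 2 := by
  let L : EuclideanSpace ℝ (Fin n) →ₗ[ℝ] EuclideanSpace ℝ (Fin n) := Matrix.toLpLin 2 2 (Matrix.diagonal a)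
  have hL : ∀ x i, L x i = a i * x i := by
    intro x i
    simp [L, Matrix.toLpLin_apply, Matrix.mulVec_diagonal]
  have hdet : LinearMap.det L = 1 := by
    rw [LinearMap.det_toLpLin, Matrix.det_diagonal, ha]
  have ha0 : ∀ i, a i ≠ 0 := by
    intro i h
    rw [Finset.prod_eq_zero (Finset.mem_univ i) h] at ha
    exact zero_ne_one ha
  let Lc : EuclideanSpace ℝ (Fin n) →L[ℝ] EuclideanSpace ℝ (Fin n) := LinearMap.toContinuousLinearMap L
  have hLc : ∀ x, Lc x = L x := fun x => rfl
  have hinj : InjOn Lc K := by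
    intro x _ y _ h
    ext i
    have h1 := hL x i
    have h2 := hL y i
    rw [hLc, hLc] at h
    rw [h, h2] at h1
    exact (mul_left_cancel₀ (ha0 i) h1).symm
  have hdc : Lc.det = 1 := by
    rw [ContinuousLinearMap.det]; exact hdet
  have key := fun g : EuclideanSpace ℝ (Fin n) → ℝ => integral_image_eq_integral_abs_det_fderiv_smul (F := ℝ) volume (f := Lc) (f' := fun _ => Lc) cK.measurableSet
    (fun x _ => Lc.hasFDerivAt.hasFDerivWithinAt) hinj g
  simp only [hdc, abs_one, one_smul] at key
  refine ⟨Lc '' K, cK.image Lc.continuous, ?_, ?_⟩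
  · have := key (fun _ => 1)
    simpa using this
  · rw [key]
    have : ∀ x, ‖Lc x‖ ^ 2 = ∑ i, (a i) ^ 2 * (x i) ^ 2 := by
      intro x
      rw [EuclideanSpace.real_norm_sq_eq]
      refine Finset.sum_congr rfl fun i _ => ?_
      rw [hLc, hL, mul_pow]
    simp_rw [this]
    rw [integral_finsetSum]
    · simp_rw [integral_const_mul]
    · intro i _
      exact cont_intOn cK (by fun_prop)

theorem ball_moment {n : ℕ} {R : ℝ} (hR : 0 < R) : ∫ x in closedBall (0 : EuclideanSpace ℝ (Fin n)) R, ‖x‖ ^ 2 =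
    R ^ (n + 2) * ∫ x in closedBall (0 : EuclideanSpace ℝ (Fin n)) 1, ‖x‖ ^ 2 := by
  rw [← closedBall_smul_one hR.le]
  exact smul_setIntegral_hom _ hR (fun x => ‖x‖ ^ 2) (by intro x; rw [norm_smul, mul_pow, Real.norm_eq_abs, sq_abs])

theorem M_pos {n : ℕ} (hn : 0 < n) : 0 < ∫ x in closedBall (0 : EuclideanSpace ℝ (Fin n)) 1, ‖x‖ ^ 2 := by
  have h1 := omega_pos n
  have h2 := omega_le (n := n)
  have hnR : (0:ℝ) < n := by exact_mod_cast hn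
  by_contra h
  push Not at h
  nlinarith [mul_pos h1 hnR]

theorem prod_y_ge {n : ℕ} (hn : 0 < n) {R : ℝ} (hR : 0 < R) {K : Set (EuclideanSpace ℝ (Fin n))} (cK : IsCompact K)
    (hvol : volume.real K = volume.real (closedBall (0 : EuclideanSpace ℝ (Fin n)) 1) * R ^ n)
    (y : Fin n → ℝ) (hy : ∀ i, 0 < y i)
    (hJ : ∀ i : Fin n, ∫ x in K, (x i) ^ 2 = (y i * R) ^ (n + 2) *
      ((∫ x in closedBall (0 : EuclideanSpace ℝ (Fin n)) 1, ‖x‖ ^ 2) / n)) : 1 ≤ ∏ i, y i := by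
  set M := ∫ x in closedBall (0 : EuclideanSpace ℝ (Fin n)) 1, ‖x‖ ^ 2 with hM
  have hM0 : 0 < M := M_pos hn
  have hnR : (0:ℝ) < n := by exact_mod_cast hn
  set P := ∏ i, y i with hP
  have hP0 : 0 < P := Finset.prod_pos fun i _ => hy i
  set g := P ^ (n : ℝ)⁻¹ with hg
  have hg0 : 0 < g := by positivity
  have hgn : g ^ n = P := Real.rpow_inv_natCast_pow hP0.le (by omega)
  clear_value g
  have ha : ∏ i, Real.sqrt ((g / y i) ^ (n + 2)) = 1 := by
    have h0 : ∀ i, 0 ≤ Real.sqrt ((g / y i) ^ (n + 2)) := fun i => Real.sqrt_nonneg _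
    have h1 : (∏ i, Real.sqrt ((g / y i) ^ (n + 2))) ^ 2 = 1 := by
      rw [← Finset.prod_pow]
      have : ∀ i, Real.sqrt ((g / y i) ^ (n + 2)) ^ 2 = (g / y i) ^ (n + 2) := fun i =>
        Real.sq_sqrt (pow_nonneg (div_nonneg hg0.le (hy i).le) _)
      simp_rw [this]
      rw [Finset.prod_pow, Finset.prod_div_distrib, ← hP]
      simp [hgn, hP0.ne']
    exact (pow_eq_one_iff_of_nonneg (Finset.prod_nonneg fun i _ => h0 i) two_ne_zero).1 h1
  obtain ⟨A, cA, vA, mA⟩ := diag_moment cK _ ha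
  obtain ⟨c, hc, hb⟩ := bathtub (n := n) hR
  have := hb A cA (vA.trans hvol)
  rw [ball_moment hR, ← hM, mA] at this
  have e : ∀ i, Real.sqrt ((g / y i) ^ (n + 2)) ^ 2 * ∫ x in K, (x i) ^ 2 = g ^ (n + 2) * (R ^ (n + 2) * (M / n)) := by
    intro i
    rw [Real.sq_sqrt (pow_nonneg (div_nonneg hg0.le (hy i).le) _), hJ i, mul_pow, div_pow]
    have := pow_ne_zero (n + 2) (hy i).ne'
    field_simp
  simp_rw [e] at this
  have e2 : ∑ _i : Fin n, g ^ (n + 2) * (R ^ (n + 2) * (M / n)) = g ^ (n + 2) * (R ^ (n + 2) * M) := by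
    simp; field_simp
  rw [e2] at this
  have hq : 0 < R ^ (n + 2) * M := by positivity
  have h1 : 1 ≤ g ^ (n + 2) := by
    have h3 : 0 ≤ c * volume.real (A \ closedBall 0 R) ^ 2 := by positivity
    refine le_of_mul_le_mul_right ?_ hq
    linarith
  have h2 : 1 ≤ g := by
    by_contra h
    push Not at h
    exact absurd h1 (not_le.2 (pow_lt_one₀ hg0.le h (by omega)))
  rw [← hgn]
  exact one_le_pow₀ h2

theorem coord_moment_pos {n : ℕ} {K : Set (EuclideanSpace ℝ (Fin n))} (cK : IsCompact K) (hK : 0 < volume.real K) (i : Fin n) :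
    0 < ∫ x in K, (x i) ^ 2 := by
  rw [setIntegral_pos_iff_support_of_nonneg_ae (Eventually.of_forall fun x => by positivity) (cont_intOn cK (by fun_prop))]
  have hker : volume ((LinearMap.ker (EuclideanSpace.proj i : EuclideanSpace ℝ (Fin n) →L[ℝ] ℝ).toLinearMap : Submodule ℝ (EuclideanSpace ℝ (Fin n))) : Set (EuclideanSpace ℝ (Fin n))) = 0 := by
    refine Measure.addHaar_submodule volume _ ?_
    intro h
    rw [LinearMap.ker_eq_top] at h
    have := LinearMap.congr_fun h (EuclideanSpace.single i (1:ℝ))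
    simp at this
  have h1 : 0 < volume K := by
    rw [measureReal_def] at hK
    exact (ENNReal.toReal_pos_iff.1 hK).1
  rw [pos_iff_ne_zero]
  intro h
  have : volume K ≤ 0 := by
    refine (measure_mono (t := (Function.support (fun x : EuclideanSpace ℝ (Fin n) => (x i) ^ 2) ∩ K) ∪ (LinearMap.ker (EuclideanSpace.proj i : EuclideanSpace ℝ (Fin n) →L[ℝ] ℝ).toLinearMap : Submodule ℝ (EuclideanSpace ℝ (Fin n)))) ?_).trans
      ((measure_union_le _ _).trans (by rw [h, hker, add_zero]))
    intro x hx
    by_cases h0 : x i = 0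
    · right; simpa using h0
    · left; exact ⟨by simpa using h0, hx⟩
  exact absurd this (not_le.2 h1)

theorem stab {n : ℕ} (hn : 0 < n) {R r : ℝ} (hR : 0 < R) (hr : 0 < r) :
    ∃ C : ℝ, 0 ≤ C ∧ ∀ K : Set (EuclideanSpace ℝ (Fin n)), Convex ℝ K → IsCompact K →
    volume.real K = volume.real (closedBall (0 : EuclideanSpace ℝ (Fin n)) 1) * R ^ n →
    ∃ x0, volume.real (K \ closedBall x0 R) ^ 2 ≤ C * (volume.real (K + closedBall 0 r)
        - volume.real (closedBall (0 : EuclideanSpace ℝ (Fin n)) 1) * (R + r) ^ n) := by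
  obtain ⟨C8, hC8, h8⟩ := sum_y_le hn hR hr
  obtain ⟨C9, hC9, h9⟩ := scalar_stab n (n + 2)
  obtain ⟨c, hc, hb⟩ := bathtub (n := n) hR
  set ω := volume.real (closedBall (0 : EuclideanSpace ℝ (Fin n)) 1) with hω
  have hω0 : 0 < ω := omega_pos n
  set M := ∫ x in closedBall (0 : EuclideanSpace ℝ (Fin n)) 1, ‖x‖ ^ 2 with hM
  have hM0 : 0 < M := M_pos hn
  have hnR : (0:ℝ) < n := by exact_mod_cast hn
  set j := M / n with hj
  have hj0 : 0 < j := by positivity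
  refine ⟨R ^ (n + 2) * j * (C9 * C8) / c + (ω * R ^ n) ^ 2 * C8, by positivity, fun K0 hK0 cK0 hv0 => ?_⟩
  obtain ⟨v, hbal⟩ := translate_balanced cK0
  set K : Set (EuclideanSpace ℝ (Fin n)) := (fun x => v + x) ⁻¹' K0 with hKdef
  have hK : Convex ℝ K := hK0.translate_preimage_right v
  have cK : IsCompact K := (Homeomorph.addLeft v).isCompact_preimage.2 cK0
  have hv : volume.real K = ω * R ^ n := by
    rw [← hv0, hKdef, measureReal_def, measure_preimage_add, ← measureReal_def]
  refine ⟨v, ?_⟩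
  have e1 : volume.real (K0 \ closedBall v R) = volume.real (K \ closedBall 0 R) := by
    have : K \ closedBall 0 R = (fun x => v + x) ⁻¹' (K0 \ closedBall v R) := by
      ext x; simp [hKdef]
    rw [this, measureReal_def, measureReal_def, measure_preimage_add]
  rw [e1, ← translate_add_vol K0 v, ← hKdef]
  set δ := volume.real (K + closedBall 0 r) - ω * (R + r) ^ n with hδ
  have hδ0 : 0 ≤ δ := (deficit_range hn hK cK.isBounded hR hv hr.le le_rfl).1
  set d := volume.real (K \ closedBall 0 R) with hd
  have hd0 : 0 ≤ d := measureReal_nonneg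
  have hdv : d ≤ ω * R ^ n := by rw [← hv]; exact measureReal_mono sdiff_subset cK.measure_lt_top.ne
  have hvpos : 0 < volume.real K := by rw [hv]; positivity
  by_cases hcase : C8 * δ ≤ 1
  · have hJpos := coord_moment_pos cK hvpos
    let y : Fin n → ℝ := fun i => ((∫ x in K, (x i) ^ 2) / (R ^ (n + 2) * j)) ^ ((n + 2 : ℕ) : ℝ)⁻¹
    have hy : ∀ i, 0 < y i := fun i => Real.rpow_pos_of_pos (div_pos (hJpos i) (by positivity)) _
    have hyp : ∀ i, y i ^ (n + 2) = (∫ x in K, (x i) ^ 2) / (R ^ (n + 2) * j) := fun i =>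
      Real.rpow_inv_natCast_pow (div_pos (hJpos i) (by positivity)).le (by omega)
    have hJ : ∀ i, ∫ x in K, (x i) ^ 2 = (y i * R) ^ (n + 2) * j := by
      intro i
      rw [mul_pow, hyp]; field_simp
    have s1 := h8 K hK cK hv hbal y hy hJ
    have s2 := prod_y_ge hn hR cK hv y hy hJ
    have s3 := h9 y (C8 * δ) hy s2 s1 hcase
    have s4 := hb K cK hv
    rw [sum_coord cK, ball_moment hR, ← hM] at s4
    simp_rw [hJ, mul_pow] at s4
    rw [← Finset.sum_mul, ← Finset.sum_mul] at s4
    have s5 : (∑ i, y i ^ (n + 2)) * R ^ (n + 2) * j ≤ (n + C9 * (C8 * δ)) * R ^ (n + 2) * j := by gcongr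
    have e2 : (n + C9 * (C8 * δ)) * R ^ (n + 2) * j = R ^ (n + 2) * M + R ^ (n + 2) * j * (C9 * C8) * δ := by
      rw [hj]; field_simp
    rw [e2] at s5
    have s6 : c * d ^ 2 ≤ R ^ (n + 2) * j * (C9 * C8) * δ := by linarith
    have s7 : d ^ 2 ≤ R ^ (n + 2) * j * (C9 * C8) / c * δ := by
      rw [div_mul_eq_mul_div, le_div_iff₀ hc]; linarith
    have s8 : 0 ≤ (ω * R ^ n) ^ 2 * C8 * δ := by positivity
    linarith
  · push Not at hcase
    have s1 : d ^ 2 ≤ (ω * R ^ n) ^ 2 := by gcongr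
    have s2 : 0 ≤ R ^ (n + 2) * j * (C9 * C8) / c * δ := by positivity
    have s3 : (ω * R ^ n) ^ 2 * 1 ≤ (ω * R ^ n) ^ 2 * (C8 * δ) := by gcongr
    linarith


theorem riesz_ball_finite {n : ℕ} (hn : 0 < n) {α : ℝ} (hαn : α < n) :
    ∫⁻ y in ball (0 : EuclideanSpace ℝ (Fin n)) 1, edist (0 : EuclideanSpace ℝ (Fin n)) y ^ (-α) < ⊤ := by
  haveI : Nonempty (Fin n) := ⟨⟨0, hn⟩⟩
  have h1 : IntegrableOn (fun x : EuclideanSpace ℝ (Fin n) => ‖x‖ ^ (-α)) (ball 0 1) := by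
    rw [integrableOn_fun_norm_addHaar volume (f := fun t : ℝ => t ^ (-α))]
    have : IntegrableOn (fun t : ℝ => t ^ ((n : ℝ) - 1 - α)) (Ioo 0 1) :=
      (intervalIntegral.integrableOn_Ioo_rpow_iff zero_lt_one).2 (by linarith)
    refine this.congr_fun ?_ measurableSet_Ioo
    intro t ht
    simp only [finrank_euclideanSpace, Fintype.card_fin, smul_eq_mul]
    rw [← Real.rpow_natCast, ← Real.rpow_add ht.1, Nat.cast_sub hn]
    push_cast
    ring_nf
  have h2 := h1.2
  rw [hasFiniteIntegral_iff_enorm] at h2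
  refine lt_of_eq_of_lt ?_ h2
  refine lintegral_congr_ae (ae_restrict_of_ae ?_)
  have : ∀ᵐ x : EuclideanSpace ℝ (Fin n), x ≠ 0 := by simp [ae_iff]
  filter_upwards [this] with x hx
  have hx' : 0 < ‖x‖ := norm_pos_iff.2 hx
  rw [edist_comm, edist_dist, dist_zero_right, ENNReal.ofReal_rpow_of_pos hx', Real.enorm_of_nonneg (by positivity)]

theorem riesz_sup {n : ℕ} (hn : 0 < n) {α : ℝ} (hα : 0 < α) (hαn : α < n) :
    ∃ S : ℝ, 0 < S ∧ ∀ (x : EuclideanSpace ℝ (Fin n)) (B : Set (EuclideanSpace ℝ (Fin n))), volume B ≤ 1 →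
      ∫⁻ y in B, edist x y ^ (-α) ≤ ENNReal.ofReal S := by
  set S0 := ∫⁻ y in ball (0 : EuclideanSpace ℝ (Fin n)) 1, edist (0 : EuclideanSpace ℝ (Fin n)) y ^ (-α) with hS0
  have hfin : S0 < ⊤ := riesz_ball_finite hn hαn
  refine ⟨S0.toReal + 1, by positivity, fun x B hB => ?_⟩
  rw [ENNReal.ofReal_add ENNReal.toReal_nonneg zero_le_one, ENNReal.ofReal_toReal hfin.ne, ENNReal.ofReal_one]
  have e : ∫⁻ y in ball x 1, edist x y ^ (-α) = S0 := by
    have := (measurePreserving_add_left volume x).setLIntegral_comp_preimage_emb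
      (Homeomorph.addLeft x).measurableEmbedding (fun y => edist x y ^ (-α)) (ball x 1)
    rw [← this, hS0]
    have hp : (fun y => x + y) ⁻¹' ball x 1 = ball 0 1 := by ext y; simp
    rw [hp]
    congr 1; ext y
    congr 1
    have := edist_add_left x 0 y
    rwa [add_zero] at this
  have h1 : B ⊆ ball x 1 ∪ (B \ ball x 1) := by
    intro y hy
    by_cases h : y ∈ ball x 1
    · exact Or.inl h
    · exact Or.inr ⟨hy, h⟩
  refine (lintegral_mono_set h1).trans ((lintegral_union_le _ _ _).trans ?_)
  rw [e]
  gcongr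
  have h2 : ∫⁻ y in B \ ball x 1, edist x y ^ (-α) ≤ ∫⁻ y in (ball x 1)ᶜ ∩ B, 1 := by
    rw [inter_comm, ← sdiff_eq]
    rw [sdiff_eq, inter_comm, ← Measure.restrict_restrict measurableSet_ball.compl]
    refine setLIntegral_mono' measurableSet_ball.compl ?_
    intro y hy
    have : 1 ≤ edist x y := by
      rw [edist_comm, edist_dist, ← ENNReal.ofReal_one]
      apply ENNReal.ofReal_le_ofReal
      simpa using hy
    exact ENNReal.rpow_le_one_of_one_le_of_neg this (by linarith)
  refine h2.trans ?_
  simp only [lintegral_const, Measure.restrict_apply_univ, one_mul]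
  exact (measure_mono inter_subset_right).trans hB

theorem riesz_compare {n : ℕ} {α S : ℝ}
    (hS : ∀ (x : EuclideanSpace ℝ (Fin n)) (B : Set (EuclideanSpace ℝ (Fin n))), volume B ≤ 1 →
      ∫⁻ y in B, edist x y ^ (-α) ≤ ENNReal.ofReal S)
    {E B : Set (EuclideanSpace ℝ (Fin n))} (hB : volume B ≤ 1) :
    ∫⁻ x in B, ∫⁻ y in B, edist x y ^ (-α) ≤
      (∫⁻ x in E, ∫⁻ y in E, edist x y ^ (-α)) + 2 * (ENNReal.ofReal S * volume (B \ E)) := by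
  have hm : Measurable (Function.uncurry fun (x y : EuclideanSpace ℝ (Fin n)) => edist x y ^ (-α)) := by
    simp only [Function.uncurry_def]
    fun_prop
  have hsplit : B ⊆ (B ∩ E) ∪ (B \ E) := by rw [inter_union_sdiff]
  have h1 : ∫⁻ x in B \ E, ∫⁻ y in B, edist x y ^ (-α) ≤ ENNReal.ofReal S * volume (B \ E) := by
    refine (lintegral_mono (fun x => hS x B hB)).trans ?_
    simp
  have h2 : ∫⁻ x in B ∩ E, ∫⁻ y in B, edist x y ^ (-α) ≤
      (∫⁻ x in E, ∫⁻ y in E, edist x y ^ (-α)) + ENNReal.ofReal S * volume (B \ E) := by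
    calc ∫⁻ x in B ∩ E, ∫⁻ y in B, edist x y ^ (-α)
        ≤ ∫⁻ x in B ∩ E, ((∫⁻ y in E, edist x y ^ (-α)) + ∫⁻ y in B \ E, edist x y ^ (-α)) := by
          refine lintegral_mono fun x => ?_
          refine (lintegral_mono_set hsplit).trans ((lintegral_union_le _ _ _).trans ?_)
          gcongr
          exact inter_subset_right
      _ = (∫⁻ x in B ∩ E, ∫⁻ y in E, edist x y ^ (-α)) + ∫⁻ x in B ∩ E, ∫⁻ y in B \ E, edist x y ^ (-α) :=
          lintegral_add_left (Measurable.lintegral_prod_right' hm) _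
      _ ≤ _ := by
          refine add_le_add (lintegral_mono_set inter_subset_right) ?_
          rw [lintegral_lintegral_swap hm.aemeasurable]
          refine (lintegral_mono (fun y => (?_ : _ ≤ ENNReal.ofReal S))).trans ?_
          · simp_rw [edist_comm _ y]
            exact hS y _ ((measure_mono inter_subset_left).trans hB)
          · simp
  refine (lintegral_mono_set hsplit).trans ((lintegral_union_le _ _ _).trans ?_)
  refine (add_le_add h2 h1).trans ?_
  rw [two_mul, add_assoc]


theorem interior_subset_density {n : ℕ} (E : Set (EuclideanSpace ℝ (Fin n))) : interior E ⊆ densityOnePoints n E := by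
  intro x hx
  rw [mem_interior_iff_mem_nhds, Metric.mem_nhds_iff] at hx
  obtain ⟨ε, hε, h⟩ := hx
  have : (fun ρ : ℝ => volume (E ∩ ball x ρ) / volume (ball x ρ)) =ᶠ[nhdsWithin 0 (Ioi 0)] fun _ => 1 := by
    filter_upwards [Ioo_mem_nhdsGT hε] with ρ hρ
    rw [inter_eq_right.2 ((ball_subset_ball hρ.2.le).trans h)]
    exact ENNReal.div_self (measure_ball_pos _ _ hρ.1).ne' measure_ball_lt_top.ne
  exact (tendsto_congr' this).2 tendsto_const_nhds

theorem density_subset_closure {n : ℕ} (E : Set (EuclideanSpace ℝ (Fin n))) : densityOnePoints n E ⊆ closure E := by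
  intro x hx
  by_contra hc
  have hx' : Tendsto (fun ρ : ℝ => volume (E ∩ ball x ρ) / volume (ball x ρ)) (nhdsWithin 0 (Ioi 0)) (nhds 1) := hx
  obtain ⟨ε, hε, h⟩ := Metric.isOpen_iff.1 isClosed_closure.isOpen_compl x hc
  have : (fun ρ : ℝ => volume (E ∩ ball x ρ) / volume (ball x ρ)) =ᶠ[nhdsWithin 0 (Ioi 0)] fun _ => 0 := by
    filter_upwards [Ioo_mem_nhdsGT hε] with ρ hρ
    have : E ∩ ball x ρ = ∅ := by
      ext y
      simp only [mem_inter_iff, mem_empty_iff_false, iff_false, not_and]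
      intro hy hy2
      exact h (ball_subset_ball hρ.2.le hy2) (subset_closure hy)
    rw [this]; simp
  have h2 := (tendsto_congr' this).1 hx'
  exact zero_ne_one (tendsto_nhds_unique tendsto_const_nhds h2)

theorem frontier_density {n : ℕ} {E : Set (EuclideanSpace ℝ (Fin n))} (hE : Convex ℝ E) (hi : (interior E).Nonempty) :
    frontier (densityOnePoints n E) = frontier E := by
  have h1 : closure (densityOnePoints n E) = closure E := by
    apply subset_antisymm
    · exact closure_minimal (density_subset_closure E) isClosed_closure
    · rw [← hE.closure_interior_eq_closure_of_nonempty_interior hi]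
      exact closure_mono (interior_subset_density E)
  have h2 : interior (densityOnePoints n E) = interior E := by
    apply subset_antisymm
    · rw [← hE.interior_closure_eq_interior_of_nonempty_interior hi]
      exact interior_mono (density_subset_closure E)
    · exact interior_maximal (interior_subset_density E) isOpen_interior
  rw [frontier, frontier, h1, h2]

theorem perR_eq {n : ℕ} (r : ℝ) {E : Set (EuclideanSpace ℝ (Fin n))} (hE : Convex ℝ E) (hi : (interior E).Nonempty) :
    perR n r E = volume (thickening r (frontier E)) / ENNReal.ofReal (2 * r) := by
  rw [perR, frontier_density hE hi, minkSum, thickening_eq_biUnion_ball]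

theorem interior_nonempty_of_vol {n : ℕ} {E : Set (EuclideanSpace ℝ (Fin n))} (hE : Convex ℝ E) (hv : volume E = 1) :
    (interior E).Nonempty := by
  rw [nonempty_iff_ne_empty]
  intro h
  have := measure_congr (convex_ae_interior hE)
  rw [h, hv] at this
  simp at this

theorem thick_cover {n : ℕ} (r : ℝ) (E : Set (EuclideanSpace ℝ (Fin n))) :
    thickening r E ⊆ thickening r (frontier E) ∪ {x | ball x r ⊆ E} := by
  intro x hx
  by_contra hc
  rw [mem_union, not_or] at hc
  obtain ⟨h1, h2⟩ := hc
  rw [mem_thickening_iff] at hx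
  obtain ⟨z, hz, hxz⟩ := hx
  have h2' : ¬ ball x r ⊆ E := h2
  rw [not_subset] at h2'
  obtain ⟨w, hw, hwE⟩ := h2'
  have hfr : ∀ u ∈ ball x r, u ∉ frontier E := by
    intro u hu huf
    exact h1 (mem_thickening_iff.2 ⟨u, huf, by rw [dist_comm]; exact hu⟩)
  have hzb : z ∈ ball x r := by rw [mem_ball, dist_comm]; exact hxz
  have hpre : IsPreconnected (ball x r) := (convex_ball x r).isPreconnected
  have := hpre (interior E) (closure E)ᶜ isOpen_interior isClosed_closure.isOpen_compl (by
    intro u hu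
    by_cases h : u ∈ interior E
    · exact Or.inl h
    · right; intro hcl; exact hfr u hu ⟨hcl, h⟩) ⟨z, hzb, by
      by_contra h; exact hfr z hzb ⟨subset_closure hz, h⟩⟩ ⟨w, hw, by
      intro h; exact hfr w hw ⟨h, fun h' => hwE (interior_subset h')⟩⟩
  obtain ⟨u, _, hu1, hu2⟩ := this
  exact hu2 (subset_closure (interior_subset hu1))

theorem inner_vol {n : ℕ} (hn : 0 < n) {R r : ℝ} (hR : 0 < R) (hr : 0 < r) {E : Set (EuclideanSpace ℝ (Fin n))} (hE : Convex ℝ E)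
    (bE : IsBounded E) (hv : volume.real E = volume.real (closedBall (0 : EuclideanSpace ℝ (Fin n)) 1) * R ^ n) :
    volume.real {x | ball x r ⊆ E} ≤ volume.real (closedBall (0 : EuclideanSpace ℝ (Fin n)) 1) * (max (R - r) 0) ^ n := by
  set ω := volume.real (closedBall (0 : EuclideanSpace ℝ (Fin n)) 1) with hω
  have hω0 : 0 < ω := omega_pos n
  set A : Set (EuclideanSpace ℝ (Fin n)) := {x | ball x r ⊆ E} with hA
  have hAE : A ⊆ E := fun x hx => hx (mem_ball_self hr)
  have hmem : ∀ x, x ∈ A ↔ ∀ u ∈ ball (0 : EuclideanSpace ℝ (Fin n)) r, x + u ∈ E := by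
    intro x
    constructor
    · intro hx u hu
      exact hx (by simpa using hu)
    · intro hx y hy
      have := hx (y - x) (by rw [mem_ball_zero_iff, ← dist_eq_norm]; exact hy)
      simpa using this
  have cA : Convex ℝ A := by
    intro x hx y hy a b ha hb hab
    rw [hmem] at hx hy ⊢
    intro u hu
    have := hE (hx u hu) (hy u hu) ha hb hab
    have e : a • (x + u) + b • (y + u) = a • x + b • y + u := by
      rw [smul_add, smul_add, add_add_add_comm, ← add_smul, hab, one_smul]
    rwa [e] at this
  by_cases h0 : volume.real A = 0
  · rw [h0]; positivity
  have hApos : 0 < volume.real A := lt_of_le_of_ne measureReal_nonneg (Ne.symm h0)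
  have hsum : A + ball 0 r ⊆ E := by
    rintro _ ⟨x, hx, u, hu, rfl⟩
    exact (hmem x).1 hx u hu
  set w := ω ^ (n : ℝ)⁻¹ with hw
  have hw0 : 0 < w := by positivity
  have hwn : w ^ n = ω := Real.rpow_inv_natCast_pow hω0.le (by omega)
  set a := (volume.real A) ^ (n : ℝ)⁻¹ with ha
  have ha0 : 0 < a := by positivity
  have han : a ^ n = volume.real A := Real.rpow_inv_natCast_pow hApos.le (by omega)
  clear_value w a
  have : Nonempty (Fin n) := ⟨⟨0, hn⟩⟩
  have hball : volume.real (ball (0 : EuclideanSpace ℝ (Fin n)) r) = ω * r ^ n := by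
    rw [measureReal_def, ← Measure.addHaar_closedBall_eq_addHaar_ball, ← measureReal_def, real_closedBall_vol hr.le]
  have h1 := bm_real hn cA (convex_ball (0 : EuclideanSpace ℝ (Fin n)) r) (bE.subset hAE) isBounded_ball ha0
    (mul_pos hw0 hr) han.le (by rw [mul_pow, hwn, hball])
  have h2 : volume.real (A + ball 0 r) ≤ volume.real E := measureReal_mono hsum bE.measure_lt_top.ne
  rw [hv, ← hwn, ← mul_pow] at h2
  have h3 : a + w * r ≤ w * R := by
    by_contra h
    push Not at h
    have := pow_lt_pow_left₀ h (by positivity) hn.ne'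
    linarith
  rw [← han, ← hwn, ← mul_pow]
  gcongr
  calc a ≤ w * (R - r) := by linarith
    _ ≤ w * max (R - r) 0 := by gcongr; exact le_max_left _ _

theorem ball_per {n : ℕ} {R r : ℝ} (hR : 0 < R) (hr : 0 < r) (x : EuclideanSpace ℝ (Fin n)) (hn : 0 < n) :
    volume.real (thickening r (frontier (ball x R))) + volume.real (closedBall (0 : EuclideanSpace ℝ (Fin n)) 1) * (max (R - r) 0) ^ n
      ≤ volume.real (closedBall (0 : EuclideanSpace ℝ (Fin n)) 1) * (R + r) ^ n := by
  rw [frontier_ball x hR.ne']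
  have hcb : ∀ s : ℝ, 0 ≤ s → volume.real (closedBall x s) = volume.real (closedBall (0 : EuclideanSpace ℝ (Fin n)) 1) * s ^ n := by
    intro s hs
    rw [← real_closedBall_vol hs, measureReal_def, measureReal_def, Measure.addHaar_closedBall_center]
  have hsub : thickening r (sphere x R) ⊆ closedBall x (R + r) := by
    intro y hy
    obtain ⟨z, hz, hyz⟩ := mem_thickening_iff.1 hy
    rw [mem_sphere] at hz
    rw [mem_closedBall]
    have := dist_triangle y z x
    linarith
  by_cases h : R ≤ r
  · rw [max_eq_right (by linarith), zero_pow hn.ne', mul_zero, add_zero, ← hcb _ (by linarith)]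
    exact measureReal_mono hsub measure_closedBall_lt_top.ne
  · push Not at h
    rw [max_eq_left (by linarith), ← hcb _ (by linarith), ← hcb _ (by linarith)]
    rw [← measureReal_union (by
      rw [Set.disjoint_left]
      intro y hy hy2
      obtain ⟨z, hz, hyz⟩ := mem_thickening_iff.1 hy
      rw [mem_sphere] at hz
      rw [mem_closedBall] at hy2
      have := dist_triangle z y x
      rw [dist_comm z y] at this
      linarith) measurableSet_closedBall (h₁ := ((measure_mono hsub).trans_lt measure_closedBall_lt_top).ne) (h₂ := measure_closedBall_lt_top.ne)]
    exact measureReal_mono (union_subset hsub (closedBall_subset_closedBall (by linarith))) measure_closedBall_lt_top.ne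

theorem thick_vol {n : ℕ} {r : ℝ} (hr : 0 < r) {E : Set (EuclideanSpace ℝ (Fin n))} (hE : Convex ℝ E) (bE : IsBounded E) :
    volume.real (closure E + closedBall 0 r) = volume.real (thickening r E) := by
  have cK : IsCompact (closure E) := bE.isCompact_closure
  rw [cK.add_closedBall_zero hr.le, cthickening_closure, ← closure_thickening hr]
  have := (hE.thickening r).addHaar_frontier volume
  apply measureReal_congr
  exact (closure_ae_eq_of_null_frontier this)

theorem per_deficit {n : ℕ} (hn : 0 < n) {R r : ℝ} (hR : 0 < R) (hr : 0 < r) {E : Set (EuclideanSpace ℝ (Fin n))} (hE : Convex ℝ E)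
    (bE : IsBounded E) (hv : volume.real E = volume.real (closedBall (0 : EuclideanSpace ℝ (Fin n)) 1) * R ^ n) (x : EuclideanSpace ℝ (Fin n)) :
    volume.real (closure E + closedBall 0 r) - volume.real (closedBall (0 : EuclideanSpace ℝ (Fin n)) 1) * (R + r) ^ n ≤
      volume.real (thickening r (frontier E)) - volume.real (thickening r (frontier (ball x R))) := by
  rw [thick_vol hr hE bE]
  have h1 := inner_vol hn hR hr hE bE hv
  have h2 := ball_per hR hr x hn
  have hAE : {x | ball x r ⊆ E} ⊆ E := fun x hx => hx (mem_ball_self hr)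
  have bF : IsBounded (frontier E) := bE.closure.subset frontier_subset_closure
  have h3 := measureReal_mono (μ := volume) (thick_cover r E) (by
    refine (measure_union_lt_top ?_ ?_).ne
    · exact bF.thickening.measure_lt_top
    · exact (bE.subset hAE).measure_lt_top)
  have h4 := measureReal_union_le (μ := volume) (thickening r (frontier E)) {x | ball x r ⊆ E}
  linarith


theorem unitRadius_spec {n : ℕ} (hn : 0 < n) : 0 < unitRadius n ∧
    volume.real (closedBall (0 : EuclideanSpace ℝ (Fin n)) 1) * unitRadius n ^ n = 1 := by
  have : Nonempty (Fin n) := ⟨⟨0, hn⟩⟩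
  have hω := omega_pos n
  have e : unitRadius n = (volume.real (closedBall (0 : EuclideanSpace ℝ (Fin n)) 1)) ^ (-(n : ℝ)⁻¹) := by
    rw [unitRadius, measureReal_def, Measure.addHaar_closedBall_eq_addHaar_ball]
  rw [e]
  refine ⟨by positivity, ?_⟩
  rw [Real.rpow_neg hω.le, inv_pow, Real.rpow_inv_natCast_pow hω.le (by omega)]
  exact mul_inv_cancel₀ hω.ne'

/-- Quantitative proximity of rescaled minimizers to the unit-volume ball. -/
theorem minimizer_close_to_ball (n : ℕ) (hn : 2 ≤ n) (α r : ℝ) (hα : 0 < α) (hαn : α < n)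
    (hr : 0 < r) :
    ∃ C : ℝ, 0 < C ∧
      ∀ (m : ℝ) (E : Set (EuclideanSpace ℝ (Fin n))), 0 < m →
        IsBounded E → Convex ℝ E → volume E = 1 →
        (∀ F : Set (EuclideanSpace ℝ (Fin n)), IsBounded F → Convex ℝ F → volume F = 1 →
          perR n r E + ENNReal.ofReal (m ^ (((n : ℝ) + 1 - α) / n)) * rieszEnergy n α E ≤
            perR n r F + ENNReal.ofReal (m ^ (((n : ℝ) + 1 - α) / n)) * rieszEnergy n α F) →
        (⨅ x : EuclideanSpace ℝ (Fin n), volume (symmDiff E (ball x (unitRadius n)))) ≤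
          ENNReal.ofReal (C * m ^ (((n : ℝ) + 1 - α) / n)) := by
  have hn0 : 0 < n := by omega
  have hne : Nonempty (Fin n) := ⟨⟨0, hn0⟩⟩
  obtain ⟨hR, hRv⟩ := unitRadius_spec hn0
  obtain ⟨C, hC0, hC⟩ := stab hn0 hR hr
  obtain ⟨S, hS0, hS⟩ := riesz_sup hn0 hα hαn
  set R := unitRadius n with hRdef
  refine ⟨8 * r * C * S + 1, by positivity, fun m E hm bE cE vE hmin => ?_⟩
  set ε := m ^ (((n : ℝ) + 1 - α) / n) with hε
  have hε0 : 0 < ε := by positivity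
  have vEr : volume.real E = 1 := by rw [measureReal_def, vE]; simp
  have hEcl : closure E =ᵐ[volume] E := closure_ae_eq_of_null_frontier (cE.addHaar_frontier volume)
  have hvK : volume.real (closure E) = volume.real (closedBall (0 : EuclideanSpace ℝ (Fin n)) 1) * R ^ n := by
    rw [measureReal_congr hEcl, vEr, hRv]
  obtain ⟨x0, hx0⟩ := hC (closure E) cE.closure bE.isCompact_closure hvK
  have hdef := per_deficit hn0 hR hr cE bE (by rw [vEr, hRv]) x0
  set F := ball x0 R with hF
  have vFr : volume.real F = 1 := by
    rw [← hRv, ← real_closedBall_vol hR.le, hF, measureReal_def, measureReal_def, Measure.addHaar_closedBall_eq_addHaar_ball,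
      Measure.addHaar_ball_center]
  have bF : IsBounded F := isBounded_ball
  have cF : Convex ℝ F := convex_ball x0 R
  have vF : volume F = 1 := by
    rw [← ENNReal.ofReal_toReal bF.measure_lt_top.ne, ← measureReal_def, vFr]; simp
  have nE : NullMeasurableSet E volume := cE.nullMeasurableSet volume
  have nF : NullMeasurableSet F volume := measurableSet_ball.nullMeasurableSet
  set d := volume.real (F \ E) with hd
  have hd0 : 0 ≤ d := measureReal_nonneg
  have hdd : volume.real (E \ F) = d := by
    have h1 := measureReal_inter_add_sdiff₀ (μ := volume) (s := E) nF (h := bE.measure_lt_top.ne)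
    have h2 := measureReal_inter_add_sdiff₀ (μ := volume) (s := F) nE (h := bF.measure_lt_top.ne)
    rw [inter_comm] at h2
    linarith
  have hdK : d ≤ volume.real (closure E \ closedBall x0 R) := by
    rw [← hdd]
    have : (closure E \ closedBall x0 R : Set (EuclideanSpace ℝ (Fin n))) =ᵐ[volume] (E \ F : Set _) := by
      refine ae_eq_set_sdiff hEcl ?_
      have := closure_ae_eq_of_null_frontier ((convex_ball x0 R).addHaar_frontier volume)
      rwa [closure_ball x0 hR.ne'] at this
    rw [measureReal_congr this]
  -- the energies
  set T₁ := volume.real (thickening r (frontier E)) with hT₁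
  set T₂ := volume.real (thickening r (frontier F)) with hT₂
  have fE : volume (thickening r (frontier E)) ≠ ⊤ :=
    ((bE.closure.subset frontier_subset_closure).thickening.measure_lt_top).ne
  have fF : volume (thickening r (frontier F)) ≠ ⊤ :=
    ((bF.closure.subset frontier_subset_closure).thickening.measure_lt_top).ne
  have pE : perR n r E = ENNReal.ofReal (T₁ / (2 * r)) := by
    rw [perR_eq r cE (interior_nonempty_of_vol cE vE), ENNReal.ofReal_div_of_pos (by positivity), hT₁, measureReal_def,
      ENNReal.ofReal_toReal fE]
  have pF : perR n r F = ENNReal.ofReal (T₂ / (2 * r)) := by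
    rw [perR_eq r cF (interior_nonempty_of_vol cF vF), ENNReal.ofReal_div_of_pos (by positivity), hT₂, measureReal_def,
      ENNReal.ofReal_toReal fF]
  have hΦfin : rieszEnergy n α E ≠ ⊤ := by
    have : rieszEnergy n α E ≤ ENNReal.ofReal S := by
      rw [rieszEnergy]
      refine (lintegral_mono (fun x => hS x E vE.le)).trans ?_
      simp [vE]
    exact (this.trans_lt ENNReal.ofReal_lt_top).ne
  set φ := (rieszEnergy n α E).toReal with hφ
  have hφ0 : 0 ≤ φ := ENNReal.toReal_nonneg
  have eΦ : rieszEnergy n α E = ENNReal.ofReal φ := (ENNReal.ofReal_toReal hΦfin).symm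
  have hcmp : rieszEnergy n α F ≤ ENNReal.ofReal (φ + 2 * (S * d)) := by
    have := riesz_compare (n := n) hS (E := E) (B := F) vF.le
    rw [ENNReal.ofReal_add hφ0 (by positivity), ← eΦ, ENNReal.ofReal_mul (by norm_num), ENNReal.ofReal_mul hS0.le, hd,
      measureReal_def, ENNReal.ofReal_toReal ((measure_mono sdiff_subset).trans_lt bF.measure_lt_top).ne]
    simpa [rieszEnergy] using this
  have hT1 : 0 ≤ T₁ := measureReal_nonneg
  have hT2 : 0 ≤ T₂ := measureReal_nonneg
  have hm1 : T₁ / (2 * r) + ε * φ ≤ T₂ / (2 * r) + ε * (φ + 2 * (S * d)) := by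
    have h1 := hmin F bF cF vF
    have h2 : perR n r F + ENNReal.ofReal ε * rieszEnergy n α F ≤ ENNReal.ofReal (T₂ / (2 * r)) + ENNReal.ofReal ε * ENNReal.ofReal (φ + 2 * (S * d)) := by
      rw [pF]; gcongr
    have h3 := h1.trans h2
    rw [pE, eΦ, ← ENNReal.ofReal_mul hε0.le, ← ENNReal.ofReal_mul hε0.le, ← ENNReal.ofReal_add (by positivity) (by positivity),
      ← ENNReal.ofReal_add (by positivity) (by positivity)] at h3
    exact (ENNReal.ofReal_le_ofReal_iff (by positivity)).1 h3
  have hm2 : T₁ - T₂ ≤ 4 * r * ε * S * d := by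
    have h4 : (T₁ - T₂) / (2 * r) ≤ 2 * ε * S * d := by rw [sub_div]; linarith
    rw [div_le_iff₀ (by positivity)] at h4
    linarith
  have hm3 : d ^ 2 ≤ C * (4 * r * ε * S * d) := by
    calc d ^ 2 ≤ volume.real (closure E \ closedBall x0 R) ^ 2 := by gcongr
      _ ≤ _ := hx0
      _ ≤ _ := by gcongr; linarith
  have hm4 : d ≤ 4 * r * C * S * ε := by
    rcases hd0.eq_or_lt with h | h
    · rw [← h]; positivity
    · refine le_of_mul_le_mul_right ?_ h
      linarith
  refine (iInf_le _ x0).trans ?_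
  have hsym : volume (symmDiff E F) ≤ ENNReal.ofReal (d + d) := by
    rw [Set.symmDiff_def]
    refine (measure_union_le _ _).trans ?_
    rw [ENNReal.ofReal_add hd0 hd0]
    nth_rewrite 1 [← hdd]
    rw [hd, measureReal_def, measureReal_def, ENNReal.ofReal_toReal ((measure_mono sdiff_subset).trans_lt bF.measure_lt_top).ne,
      ENNReal.ofReal_toReal ((measure_mono sdiff_subset).trans_lt bE.measure_lt_top).ne]
  refine hsym.trans (ENNReal.ofReal_le_ofReal ?_)
  linarith
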